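/- Let B be a separable C*-algebra, D a C*-algebra, I a closed two-sided ideal of D, and q: D → D/I the quotient map. Let φ, ψ: B → D/I be homotopic *-homomorphisms and suppose ψ lifts to a (discrete) asymptotic homomorphism from B to D. Then φ lifts to a (discrete) asymptotic homomorphism from B to D. Moreover, the whole homotopy lifts: if Φ: B → C([0,1], D/I) is the homotopy with ev_0∘Φ = ψ and ev_1∘Φ = φ, then there is a (discrete) asymptotic homomorphism (Γ_λ): B → C([0,1], D) with (ev at each t composed with) q∘Γ_λ = Φ for every λ. -/

import Mathlib

open Filter Topology

noncomputable section

/-- A (continuous) asymptotic homomorphism between C*-algebras, indexed by `ℝ≥0 = [0,∞)`. -/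
def IsAsymptoticHom {A B : Type*} [NonUnitalCStarAlgebra A] [NonUnitalCStarAlgebra B]
    (f : NNReal → A → B) : Prop :=
  (∀ a : A, Continuous fun t => f t a) ∧
  (∀ a b : A, Tendsto (fun t => ‖f t (a * b) - f t a * f t b‖) atTop (𝓝 0)) ∧
  (∀ (μ₁ μ₂ : ℂ) (a b : A),
    Tendsto (fun t => ‖f t (μ₁ • a + μ₂ • b) - (μ₁ • f t a + μ₂ • f t b)‖) atTop (𝓝 0)) ∧
  (∀ a : A, Tendsto (fun t => ‖f t (star a) - star (f t a)‖) atTop (𝓝 0))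

/-- A discrete asymptotic homomorphism between C*-algebras, indexed by `ℕ`. -/
def IsDiscreteAsymptoticHom {A B : Type*} [NonUnitalCStarAlgebra A] [NonUnitalCStarAlgebra B]
    (f : ℕ → A → B) : Prop :=
  (∀ a b : A, Tendsto (fun n => ‖f n (a * b) - f n a * f n b‖) atTop (𝓝 0)) ∧
  (∀ (μ₁ μ₂ : ℂ) (a b : A),
    Tendsto (fun n => ‖f n (μ₁ • a + μ₂ • b) - (μ₁ • f n a + μ₂ • f n b)‖) atTop (𝓝 0)) ∧
  (∀ a : A, Tendsto (fun n => ‖f n (star a) - star (f n a)‖) atTop (𝓝 0)) ∧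
  (∀ a : A, ∃ C : ℝ, ∀ n, ‖f n a‖ ≤ C)

section Cayley

variable {A : Type*} [CStarAlgebra A]

/-- Stinespring-type identity for the compression `(x, y) ↦ v x v + w y w`. -/
lemma conj_add_conj_defect {R : Type*} [Ring R] {v w : R} (hvw : v * w = w * v)
    (h1 : v * v + w * w = 1) (x y x' y' : R) :
    v * (x * x') * v + w * (y * y') * w
      = (v * x * v + w * y * w) * (v * x' * v + w * y' * w)
        + (v * x * w - w * y * v) * (w * x' * v - v * y' * w) := by
  have key : (v * x * v + w * y * w) * (v * x' * v + w * y' * w)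
        + (v * x * w - w * y * v) * (w * x' * v - v * y' * w)
      = v * x * (v * v + w * w) * x' * v + w * y * (v * v + w * w) * y' * w
        + v * x * (v * w - w * v) * y' * w + w * y * (w * v - v * w) * x' * v := by
    noncomm_ring
  rw [key, h1, hvw]
  noncomm_ring

lemma norm_conj_add_conj_le {v w : A} (hv : IsSelfAdjoint v) (hw : IsSelfAdjoint w)
    (hvw : v * w = w * v) (h1 : v * v + w * w = 1) {x y : A} {M : ℝ} (hx : ‖x‖ ≤ M)
    (hy : ‖y‖ ≤ M) : ‖v * x * v + w * y * w‖ ≤ M := by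
  let _ := CStarAlgebra.spectralOrder A
  let _ := CStarAlgebra.spectralOrderedRing A
  have hM : 0 ≤ M := (norm_nonneg x).trans hx
  have hb : ∀ z : A, ‖z‖ ≤ M → star z * z ≤ algebraMap ℝ A (M ^ 2) := fun z hz =>
    CStarAlgebra.star_mul_le_algebraMap_norm_sq.trans
      (algebraMap_mono A (pow_le_pow_left₀ (norm_nonneg z) hz 2))
  have hc : ∀ (u z : A), IsSelfAdjoint u → ‖z‖ ≤ M →
      u * (star z * z) * u ≤ algebraMap ℝ A (M ^ 2) * (u * u) := fun u z hu hz => by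
    have := star_left_conjugate_le_conjugate (hb z hz) u
    rw [hu.star_eq] at this
    refine this.trans_eq ?_
    rw [← Algebra.commutes (R := ℝ), mul_assoc]
  set z := v * x * v + w * y * w with hz
  have hsz : star z = v * star x * v + w * star y * w := by
    simp [hz, hv.star_eq, hw.star_eq, mul_assoc]
  set k := w * x * v - v * y * w with hk
  have hsk : star k = v * star x * w - w * star y * v := by
    simp [hk, hv.star_eq, hw.star_eq, mul_assoc]
  have key := conj_add_conj_defect hvw h1 (star x) (star y) x y
  rw [← hsz, ← hsk, ← hz, ← hk] at key
  have hle : star z * z ≤ algebraMap ℝ A (M ^ 2) := by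
    calc star z * z ≤ star z * z + star k * k := le_add_of_nonneg_right (star_mul_self_nonneg k)
      _ ≤ algebraMap ℝ A (M ^ 2) * (v * v) + algebraMap ℝ A (M ^ 2) * (w * w) := by
          rw [← key]; exact add_le_add (hc v x hv hx) (hc w y hw hy)
      _ = algebraMap ℝ A (M ^ 2) := by rw [← mul_add, h1, mul_one]
  have := (CStarAlgebra.norm_le_iff_le_algebraMap _ (sq_nonneg M) (star_mul_self_nonneg z)).2 hle
  rw [CStarRing.norm_star_mul_self, ← sq] at this
  exact le_of_sq_le_sq this hM

/-- For self-adjoint `h`, the imaginary part `2 * h / (1 + h²)` of the Cayley transform of `h`. -/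
def cayleySin (h : A) : A := 2 * (h * Ring.inverse (1 + h * h))

/-- For self-adjoint `h`, the real part `(1 - h²) / (1 + h²)` of the Cayley transform of `h`. -/
def cayleyCos (h : A) : A := 2 * Ring.inverse (1 + h * h) - 1

lemma isUnit_one_add_mul_self {h : A} (hh : IsSelfAdjoint h) : IsUnit (1 + h * h) := by
  let _ := CStarAlgebra.spectralOrder A
  let _ := CStarAlgebra.spectralOrderedRing A
  have : (0 : A) ≤ h * h := hh.mul_self_nonneg
  exact CStarAlgebra.isUnit_of_le (1 : A) (le_add_of_nonneg_right this)

lemma inverse_one_add_mul_self_comm {h : A} (hh : IsSelfAdjoint h) :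
    h * Ring.inverse (1 + h * h) = Ring.inverse (1 + h * h) * h := by
  have hu := isUnit_one_add_mul_self hh
  set r := Ring.inverse (1 + h * h)
  have h1 : (1 + h * h) * r = 1 := Ring.mul_inverse_cancel _ hu
  have h2 : r * (1 + h * h) = 1 := Ring.inverse_mul_cancel _ hu
  calc h * r = (r * (1 + h * h)) * h * r := by rw [h2, one_mul]
    _ = r * h * ((1 + h * h) * r) := by noncomm_ring
    _ = r * h := by rw [h1, mul_one]

lemma isSelfAdjoint_inverse_one_add_mul_self {h : A} (hh : IsSelfAdjoint h) :
    IsSelfAdjoint (Ring.inverse (1 + h * h)) := by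
  have : IsSelfAdjoint (1 + h * h) := (IsSelfAdjoint.one A).add (by
    simpa [hh.star_eq] using IsSelfAdjoint.star_mul_self h)
  rw [IsSelfAdjoint, ← Ring.inverse_star, this.star_eq]

lemma norm_inverse_one_add_mul_self_le {h : A} (hh : IsSelfAdjoint h) :
    ‖Ring.inverse (1 + h * h)‖ ≤ 1 := by
  let _ := CStarAlgebra.spectralOrder A
  let _ := CStarAlgebra.spectralOrderedRing A
  have hu := isUnit_one_add_mul_self hh
  have hs := isSelfAdjoint_inverse_one_add_mul_self hh
  set r := Ring.inverse (1 + h * h)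
  have h2 : r * (1 + h * h) = 1 := Ring.inverse_mul_cancel _ hu
  have key : star r * r + star (h * r) * (h * r) = r := by
    calc star r * r + star (h * r) * (h * r) = r * (1 + h * h) * r := by
          rw [star_mul, hs.star_eq, hh.star_eq]; noncomm_ring
      _ = r := by rw [h2, one_mul]
  have hle : star r * r ≤ r := by
    conv_rhs => rw [← key]
    exact le_add_of_nonneg_right (star_mul_self_nonneg _)
  have := CStarAlgebra.norm_le_norm_of_nonneg_of_le (star_mul_self_nonneg r) hle
  rw [CStarRing.norm_star_mul_self] at this
  by_contra hlt
  push Not at hlt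
  nlinarith

lemma isSelfAdjoint_cayleySin {h : A} (hh : IsSelfAdjoint h) : IsSelfAdjoint (cayleySin h) := by
  have hs := isSelfAdjoint_inverse_one_add_mul_self hh
  rw [IsSelfAdjoint, cayleySin, star_mul, star_mul, hs.star_eq, hh.star_eq,
    ← inverse_one_add_mul_self_comm hh, star_ofNat, (Commute.ofNat_left 2 _).eq]

lemma isSelfAdjoint_cayleyCos {h : A} (hh : IsSelfAdjoint h) : IsSelfAdjoint (cayleyCos h) := by
  have hs := isSelfAdjoint_inverse_one_add_mul_self hh
  rw [IsSelfAdjoint, cayleyCos, star_sub, star_mul, hs.star_eq, star_one, star_ofNat,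
    (Commute.ofNat_left 2 _).eq]

lemma cayleySin_mul_cayleyCos {h : A} (hh : IsSelfAdjoint h) :
    cayleySin h * cayleyCos h = cayleyCos h * cayleySin h := by
  have hc := inverse_one_add_mul_self_comm hh
  rw [cayleySin, cayleyCos]
  set r := Ring.inverse (1 + h * h)
  calc 2 * (h * r) * (2 * r - 1) = 4 * ((h * r) * r) - 2 * (h * r) := by noncomm_ring
    _ = (2 * r - 1) * (2 * (h * r)) := by rw [hc]; nth_rw 1 [mul_assoc, hc]; noncomm_ring

lemma cayleySin_sq_add_cayleyCos_sq {h : A} (hh : IsSelfAdjoint h) :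
    cayleySin h * cayleySin h + cayleyCos h * cayleyCos h = 1 := by
  have hc := inverse_one_add_mul_self_comm hh
  have h2 := Ring.inverse_mul_cancel _ (isUnit_one_add_mul_self hh)
  rw [cayleySin, cayleyCos]
  set r := Ring.inverse (1 + h * h)
  calc 2 * (h * r) * (2 * (h * r)) + (2 * r - 1) * (2 * r - 1)
      = 4 * ((h * r) * (h * r)) + 4 * (r * r) - 4 * r + 1 := by noncomm_ring
    _ = 4 * (r * (1 + h * h) * r) - 4 * r + 1 := by nth_rw 1 [hc]; noncomm_ring
    _ = 1 := by rw [h2, one_mul]; noncomm_ring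

end Cayley

section Bounds

variable {A : Type*} [CStarAlgebra A]

lemma norm_le_one_of_mul_self_add_mul_self {v w : A} (hv : IsSelfAdjoint v)
    (hw : IsSelfAdjoint w) (hvw : v * w = w * v) (h1 : v * v + w * w = 1) : ‖v‖ ≤ 1 := by
  have hone : ‖(1 : A)‖ ≤ 1 := by
    cases subsingleton_or_nontrivial A
    · simp [Subsingleton.elim (1 : A) 0]
    · exact CStarRing.norm_one.le
  have := norm_conj_add_conj_le hv hw hvw h1 (x := 1) (y := 0) hone (by simp)
  rw [mul_one, mul_zero, zero_mul, add_zero] at this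
  have h2 : ‖v‖ * ‖v‖ ≤ 1 := by
    rw [← CStarRing.norm_star_mul_self, hv.star_eq]; exact this
  nlinarith [norm_nonneg v]

lemma norm_conj_le {v : A} (hv : ‖v‖ ≤ 1) {x : A} {c : ℝ} (hx : ‖x‖ ≤ c) : ‖v * x * v‖ ≤ c := by
  have h0 := norm_nonneg x
  have hv0 := norm_nonneg v
  calc ‖v * x * v‖ ≤ ‖v‖ * ‖x‖ * ‖v‖ := norm_mul₃_le
    _ ≤ 1 * ‖x‖ * 1 := by gcongr
    _ ≤ c := by simpa

lemma norm_mul_le_of_le_one_left {v : A} (hv : ‖v‖ ≤ 1) {x : A} {c : ℝ} (hx : ‖x‖ ≤ c) :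
    ‖v * x‖ ≤ c :=
  (norm_mul_le v x).trans ((mul_le_mul hv hx (norm_nonneg x) zero_le_one).trans_eq (one_mul c))

lemma norm_mul_le_of_le_one_right {v : A} (hv : ‖v‖ ≤ 1) {x : A} {c : ℝ} (hx : ‖x‖ ≤ c) :
    ‖x * v‖ ≤ c :=
  (norm_mul_le x v).trans ((mul_le_mul hx hv (norm_nonneg v)
    ((norm_nonneg x).trans hx)).trans_eq (mul_one c))

/-- The multiplicativity defect of the compression `(x, y) ↦ v x v + w y w` when `v`, `w` almost
commute with the entries and `w` almost annihilates the relevant defects. -/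
lemma norm_conj_add_conj_mul_defect_le {v w : A} (hv : IsSelfAdjoint v) (hw : IsSelfAdjoint w)
    (hvw : v * w = w * v) (h1 : v * v + w * w = 1) {x x' x'' y y' y'' p : A} {M κ η : ℝ}
    (hM : 1 ≤ M) (hx : ‖x‖ ≤ M) (hx' : ‖x'‖ ≤ M) (hy : ‖y‖ ≤ M) (hy' : ‖y'‖ ≤ M)
    (cxv : ‖v * x - x * v‖ ≤ κ) (cxv' : ‖v * x' - x' * v‖ ≤ κ) (cyv : ‖v * y - y * v‖ ≤ κ)
    (cxw : ‖w * x - x * w‖ ≤ κ) (cxw' : ‖w * x' - x' * w‖ ≤ κ)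
    (hdef : ‖w * (y'' - y * y')‖ ≤ κ) (hp : ‖w * ((x - y) * (x' - y') - p)‖ ≤ κ)
    (hη : ‖x'' - x * x'‖ ≤ η) (hpη : ‖p‖ ≤ η) :
    ‖v * x'' * v + w * y'' * w - (v * x * v + w * y * w) * (v * x' * v + w * y' * w)‖
      ≤ η + 18 * M * κ := by
  have hv1 := norm_le_one_of_mul_self_add_mul_self hv hw hvw h1
  have hw1 := norm_le_one_of_mul_self_add_mul_self hw hv hvw.symm (by rwa [add_comm])
  have hκ : 0 ≤ κ := (norm_nonneg _).trans cxv
  set k := v * x * w - w * y * v with hk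
  set k' := w * x' * v - v * y' * w with hk'
  set a := x - y with ha
  set b := x' - y' with hb
  have hk1 : k - w * a * v = v * (x * w - w * x) + w * (v * x - x * v) + (v * w - w * v) * x := by
    rw [hk, ha]; noncomm_ring
  have hk2 : k' - v * b * w
      = w * (x' * v - v * x') + v * (w * x' - x' * w) + (w * v - v * w) * x' := by
    rw [hk', hb]; noncomm_ring
  rw [hvw, sub_self, zero_mul, add_zero] at hk1 hk2
  have nk1 : ‖k - w * a * v‖ ≤ 2 * κ := by
    rw [hk1]
    refine (norm_add_le_of_le (norm_mul_le_of_le_one_left hv1 (c := κ) ?_)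
      (norm_mul_le_of_le_one_left hw1 cxv)).trans_eq (by ring)
    rwa [norm_sub_rev]
  have nk2 : ‖k' - v * b * w‖ ≤ 2 * κ := by
    rw [hk2]
    refine (norm_add_le_of_le (norm_mul_le_of_le_one_left hw1 (c := κ) ?_)
      (norm_mul_le_of_le_one_left hv1 cxw')).trans_eq (by ring)
    rwa [norm_sub_rev]
  have nk' : ‖k'‖ ≤ 2 * M := by
    refine (norm_sub_le_of_le
      (norm_mul_le_of_le_one_right hv1 (norm_mul_le_of_le_one_left hw1 hx'))
      (norm_mul_le_of_le_one_right hw1 (norm_mul_le_of_le_one_left hv1 hy'))).trans_eq (by ring)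
  have na : ‖a‖ ≤ 2 * M := (norm_sub_le_of_le hx hy).trans_eq (by ring)
  have nb : ‖b‖ ≤ 2 * M := (norm_sub_le_of_le hx' hy').trans_eq (by ring)
  have nav : ‖a * v - v * a‖ ≤ 2 * κ := by
    have : a * v - v * a = (v * y - y * v) - (v * x - x * v) := by rw [ha]; noncomm_ring
    rw [this]
    exact (norm_sub_le_of_le cyv cxv).trans_eq (by ring)
  have nc : ‖a * (v * v) - v * v * a‖ ≤ 4 * κ := by
    have : a * (v * v) - v * v * a = (a * v - v * a) * v + v * (a * v - v * a) := by noncomm_ring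
    rw [this]
    exact (norm_add_le_of_le (norm_mul_le_of_le_one_right hv1 nav)
      (norm_mul_le_of_le_one_left hv1 nav)).trans_eq (by ring)
  have split : v * x'' * v + w * y'' * w
        - (v * x * v + w * y * w) * (v * x' * v + w * y' * w)
      = (v * (x'' - x * x') * v + w * (v * v * p) * w) + (w * (y'' - y * y')) * w
        + (k - w * a * v) * k' + (w * a * v) * (k' - v * b * w)
        + w * ((a * (v * v) - v * v * a) * b) * w
        + (v * v) * (w * (a * b - p)) * w + (w * v * v - v * v * w) * (a * b - p) * w := by
    have := conj_add_conj_defect hvw h1 x y x' y'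
    rw [← hk, ← hk'] at this
    have e : v * x'' * v + w * y'' * w
        - (v * x * v + w * y * w) * (v * x' * v + w * y' * w)
        = v * (x'' - x * x') * v + w * (y'' - y * y') * w
          + ((v * (x * x') * v + w * (y * y') * w)
            - (v * x * v + w * y * w) * (v * x' * v + w * y' * w)) := by
      noncomm_ring
    rw [e, this]
    noncomm_ring
  have e0 : w * v * v - v * v * w = 0 := by
    rw [← hvw, mul_assoc, ← hvw, mul_assoc, sub_self]
  rw [split, e0, zero_mul, zero_mul, add_zero]
  have b1 : ‖v * (x'' - x * x') * v + w * (v * v * p) * w‖ ≤ η :=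
    norm_conj_add_conj_le hv hw hvw h1 hη
      (by rw [mul_assoc]
          exact norm_mul_le_of_le_one_left hv1 (norm_mul_le_of_le_one_left hv1 hpη))
  have b2 : ‖(w * (y'' - y * y')) * w‖ ≤ κ := norm_mul_le_of_le_one_right hw1 hdef
  have b3 : ‖(k - w * a * v) * k'‖ ≤ 2 * κ * (2 * M) :=
    norm_mul_le_of_le nk1 nk'
  have b4 : ‖(w * a * v) * (k' - v * b * w)‖ ≤ 2 * M * (2 * κ) :=
    norm_mul_le_of_le
      (norm_mul_le_of_le_one_right hv1 (norm_mul_le_of_le_one_left hw1 na)) nk2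
  have b5 : ‖w * ((a * (v * v) - v * v * a) * b) * w‖ ≤ 4 * κ * (2 * M) :=
    norm_conj_le hw1 (norm_mul_le_of_le nc nb)
  have b6 : ‖(v * v) * (w * (a * b - p)) * w‖ ≤ κ := by
    rw [mul_assoc v v]
    exact norm_mul_le_of_le_one_right hw1 (norm_mul_le_of_le_one_left hv1
      (norm_mul_le_of_le_one_left hv1 hp))
  have hfin : η + κ + 2 * κ * (2 * M) + 2 * M * (2 * κ) + 4 * κ * (2 * M) + κ
      ≤ η + 18 * M * κ := by nlinarith
  exact (norm_add_le_of_le (norm_add_le_of_le (norm_add_le_of_le (norm_add_le_of_le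
    (norm_add_le_of_le b1 b2) b3) b4) b5) b6).trans hfin

lemma norm_inverse_one_add_mul_self_commutator_le {h : A} (hh : IsSelfAdjoint h) (hn : ‖h‖ ≤ 1)
    {z : A} {δ : ℝ} (hz : ‖h * z - z * h‖ ≤ δ) :
    ‖Ring.inverse (1 + h * h) * z - z * Ring.inverse (1 + h * h)‖ ≤ 2 * δ := by
  have hr := norm_inverse_one_add_mul_self_le hh
  have h1 := Ring.mul_inverse_cancel _ (isUnit_one_add_mul_self hh)
  have h2 := Ring.inverse_mul_cancel _ (isUnit_one_add_mul_self hh)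
  set r := Ring.inverse (1 + h * h)
  have key : r * z - z * r = r * (h * (z * h - h * z) + (z * h - h * z) * h) * r := by
    calc r * z - z * r = r * z * ((1 + h * h) * r) - (r * (1 + h * h)) * z * r := by
          rw [h1, h2, mul_one, one_mul]
      _ = _ := by noncomm_ring
  rw [key]
  have hz' : ‖z * h - h * z‖ ≤ δ := by rwa [norm_sub_rev]
  refine norm_conj_le hr ((norm_add_le_of_le (norm_mul_le_of_le_one_left hn hz')
    (norm_mul_le_of_le_one_right hn hz')).trans_eq (by ring))

lemma norm_two_mul_le {x : A} {c : ℝ} (hx : ‖x‖ ≤ c) : ‖2 * x‖ ≤ 2 * c := by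
  rw [two_mul, two_mul]; exact norm_add_le_of_le hx hx

lemma norm_cayleyCos_commutator_le {h : A} (hh : IsSelfAdjoint h) (hn : ‖h‖ ≤ 1)
    {z : A} {δ : ℝ} (hz : ‖h * z - z * h‖ ≤ δ) :
    ‖cayleyCos h * z - z * cayleyCos h‖ ≤ 6 * δ := by
  have hδ : 0 ≤ δ := (norm_nonneg _).trans hz
  have := norm_two_mul_le (norm_inverse_one_add_mul_self_commutator_le hh hn hz)
  rw [cayleyCos]
  set r := Ring.inverse (1 + h * h)
  have e : (2 * r - 1) * z - z * (2 * r - 1) = 2 * (r * z - z * r) := by noncomm_ring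
  rw [e]
  linarith

lemma norm_cayleySin_commutator_le {h : A} (hh : IsSelfAdjoint h) (hn : ‖h‖ ≤ 1)
    {z : A} {δ : ℝ} (hz : ‖h * z - z * h‖ ≤ δ) :
    ‖cayleySin h * z - z * cayleySin h‖ ≤ 6 * δ := by
  have hr := norm_inverse_one_add_mul_self_le hh
  have hc := norm_inverse_one_add_mul_self_commutator_le hh hn hz
  rw [cayleySin]
  set r := Ring.inverse (1 + h * h)
  have e : 2 * (h * r) * z - z * (2 * (h * r)) = 2 * (h * (r * z - z * r) + (h * z - z * h) * r) := by
    noncomm_ring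
  rw [e]
  refine (norm_two_mul_le (norm_add_le_of_le (norm_mul_le_of_le_one_left hn hc)
    (norm_mul_le_of_le_one_right hr hz))).trans_eq (by ring)

lemma norm_cayleyCos_mul_le {h : A} (hh : IsSelfAdjoint h) (hn : ‖h‖ ≤ 1)
    {x : A} {δ : ℝ} (hx : ‖(1 - h) * x‖ ≤ δ) : ‖cayleyCos h * x‖ ≤ 6 * δ := by
  have hδ : 0 ≤ δ := (norm_nonneg _).trans hx
  have hr := norm_inverse_one_add_mul_self_le hh
  have h2 := Ring.inverse_mul_cancel _ (isUnit_one_add_mul_self hh)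
  rw [cayleyCos]
  set r := Ring.inverse (1 + h * h)
  have e : (2 * r - 1) * x = r * ((1 - h) * x + h * ((1 - h) * x)) := by
    calc (2 * r - 1) * x = (2 * r - r * (1 + h * h)) * x := by rw [h2]
      _ = _ := by noncomm_ring
  rw [e]
  have := norm_mul_le_of_le_one_left hr (norm_add_le_of_le hx (norm_mul_le_of_le_one_left hn hx))
  linarith

end Bounds

section QuasiCentral

variable {A Q : Type*} [CStarAlgebra A] [CStarAlgebra Q]

lemma exists_approx_unit_ker (π : A →⋆ₐ[ℂ] Q) (S : Finset A) (hS : ∀ x ∈ S, π x = 0) {δ : ℝ}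
    (hδ : 0 < δ) :
    ∃ u : A, IsSelfAdjoint u ∧ ‖u‖ ≤ 1 ∧ π u = 0 ∧ ∀ x ∈ S, ‖(1 - u) * x‖ ≤ δ := by
  let _ := CStarAlgebra.spectralOrder A
  let _ := CStarAlgebra.spectralOrderedRing A
  set c : ℝ := (δ ^ 2)⁻¹ with hc
  have hc0 : 0 < c := by positivity
  set a : A := ∑ x ∈ S, x * star x with ha
  have ha0 : 0 ≤ c • a := smul_nonneg hc0.le (Finset.sum_nonneg fun x _ => mul_star_self_nonneg x)
  have hπa : π (c • a) = 0 := by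
    have : π a = 0 := by
      rw [ha, map_sum]
      exact Finset.sum_eq_zero fun x hx => by rw [map_mul, hS x hx, zero_mul]
    rw [← Complex.coe_smul, map_smul, this, smul_zero]
  obtain ⟨h, hh, hha⟩ : ∃ h : A, IsSelfAdjoint h ∧ h * h = c • a :=
    ⟨CFC.sqrt (c • a), IsSelfAdjoint.of_nonneg (CFC.sqrt_nonneg _), CFC.sqrt_mul_sqrt_self _ ha0⟩
  have hr := norm_inverse_one_add_mul_self_le hh
  have hs := isSelfAdjoint_inverse_one_add_mul_self hh
  have hcomm := inverse_one_add_mul_self_comm hh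
  have h2 := Ring.inverse_mul_cancel _ (isUnit_one_add_mul_self hh)
  set r := Ring.inverse (1 + h * h) with hrdef
  have key : star r * r + star (h * r) * (h * r) = r := by
    calc star r * r + star (h * r) * (h * r) = r * (1 + h * h) * r := by
          rw [star_mul, hs.star_eq, hh.star_eq]; noncomm_ring
      _ = r := by rw [h2, one_mul]
  have hr0 : 0 ≤ r := by
    rw [← key]; exact add_nonneg (star_mul_self_nonneg _) (star_mul_self_nonneg _)
  have hu : 1 - r = r * (h * h) := by
    calc 1 - r = r * (1 + h * h) - r := by rw [h2]
      _ = _ := by noncomm_ring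
  have hu0 : 0 ≤ 1 - r := by
    have : 1 - r = star h * r * h := by rw [hu, ← mul_assoc, ← hcomm, hh.star_eq]
    rw [this]; exact star_left_conjugate_nonneg hr0 h
  refine ⟨1 - r, (IsSelfAdjoint.one A).sub hs, ?_, ?_, fun x hx => ?_⟩
  · exact (CStarAlgebra.norm_le_one_iff_of_nonneg _ hu0).2 (sub_le_self 1 hr0)
  · rw [hu, map_mul, hha, hπa, mul_zero]
  · rw [sub_sub_cancel]
    have h3 : star (h * r) * (h * r) ≤ r := by
      conv_rhs => rw [← key]
      exact le_add_of_nonneg_left (star_mul_self_nonneg _)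
    have h4 : star (h * r) * (h * r) = c • (r * a * r) := by
      rw [star_mul, hs.star_eq, hh.star_eq, mul_assoc, ← mul_assoc h h, hha]
      simp [mul_assoc]
    have hxa : x * star x ≤ a :=
      Finset.single_le_sum (f := fun x : A => x * star x) (fun x _ => mul_star_self_nonneg x) hx
    have h5 : r * (x * star x) * r ≤ r * a * r := by
      simpa [hs.star_eq] using star_left_conjugate_le_conjugate hxa r
    have h6 : (r * x) * star (r * x) = r * (x * star x) * r := by
      rw [star_mul, hs.star_eq]; noncomm_ring
    have h7 : ‖r * x‖ * ‖r * x‖ ≤ ‖r * a * r‖ := by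
      rw [← CStarRing.norm_self_mul_star, h6]
      exact CStarAlgebra.norm_le_norm_of_nonneg_of_le
        (by rw [← h6]; exact mul_star_self_nonneg _) h5
    have h8 : c * ‖r * a * r‖ ≤ 1 := by
      have := (CStarAlgebra.norm_le_norm_of_nonneg_of_le (star_mul_self_nonneg _) h3).trans hr
      rwa [h4, norm_smul, Real.norm_of_nonneg hc0.le] at this
    have h9 : ‖r * a * r‖ ≤ δ ^ 2 := by
      rw [hc, inv_mul_le_iff₀ (by positivity), mul_one] at h8
      exact h8
    exact abs_le_of_sq_le_sq' (by nlinarith) hδ.le |>.2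

lemma norm_sum_sq_le_of_almost_orthogonal (c : ℕ → A) {M ε : ℝ} (hM : ∀ k, ‖c k‖ ≤ M)
    (hε0 : 0 ≤ ε) (hε : ∀ j k, j < k → ‖star (c j) * c k‖ ≤ ε) (n : ℕ) :
    ‖∑ k ∈ Finset.range n, c k‖ ^ 2 ≤ n * M ^ 2 + n ^ 2 * ε := by
  have hb : ∀ j k, ‖star (c j) * c k‖ ≤ (if j = k then M ^ 2 else 0) + ε := by
    intro j k
    rcases lt_trichotomy j k with h | h | h
    · simpa [h.ne] using hε j k h
    · subst h
      rw [CStarRing.norm_star_mul_self, if_pos rfl]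
      nlinarith [hM j, norm_nonneg (c j)]
    · have := hε k j h
      rw [← norm_star, star_mul, star_star] at this
      simpa [h.ne'] using this
  calc ‖∑ k ∈ Finset.range n, c k‖ ^ 2
      = ‖∑ j ∈ Finset.range n, ∑ k ∈ Finset.range n, star (c j) * c k‖ := by
        rw [sq, ← CStarRing.norm_star_mul_self, star_sum, Finset.sum_mul_sum]
    _ ≤ ∑ j ∈ Finset.range n, ∑ k ∈ Finset.range n, ((if j = k then M ^ 2 else 0) + ε) :=
        norm_sum_le_of_le _ fun j _ => norm_sum_le_of_le _ fun k _ => hb j k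
    _ = ∑ j ∈ Finset.range n, (M ^ 2 + n * ε) := by
        refine Finset.sum_congr rfl fun j hj => ?_
        rw [Finset.sum_add_distrib, Finset.sum_ite_eq, if_pos hj]
        simp
    _ = n * M ^ 2 + n ^ 2 * ε := by simp; ring

/-- Existence of quasicentral approximate units for the kernel of a `⋆`-homomorphism. -/
lemma exists_quasicentral_ker (π : A →⋆ₐ[ℂ] Q) (Z X : Finset A) (hX : ∀ x ∈ X, π x = 0) {δ : ℝ}
    (hδ : 0 < δ) :
    ∃ h : A, IsSelfAdjoint h ∧ ‖h‖ ≤ 1 ∧ π h = 0 ∧ (∀ z ∈ Z, ‖h * z - z * h‖ < δ) ∧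
      ∀ x ∈ X, ‖(1 - h) * x‖ < δ := by
  classical
  obtain ⟨M, hM0, hM⟩ : ∃ M : ℝ, 0 ≤ M ∧ ∀ z ∈ Z, ‖z‖ ≤ M :=
    ⟨∑ z ∈ Z, ‖z‖, Finset.sum_nonneg fun z _ => norm_nonneg z, fun z hz =>
      Finset.single_le_sum (f := fun z : A => ‖z‖) (fun z _ => norm_nonneg z) hz⟩
  set ε : ℝ := δ ^ 2 / 4 with hε
  have hε0 : 0 < ε := by positivity
  set ε' : ℝ := min (δ / 2) (ε / (M + 1)) with hε'
  have hε'0 : 0 < ε' := by positivity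
  obtain ⟨u, hu, hr⟩ := exists_seq_of_forall_finset_exists
    (fun u : A => IsSelfAdjoint u ∧ ‖u‖ ≤ 1 ∧ π u = 0 ∧ ∀ x ∈ X, ‖(1 - u) * x‖ ≤ ε')
    (fun x y => ∀ z ∈ Z, ‖(1 - y) * (x * z - z * x)‖ ≤ ε' ∧
      ‖(1 - y) * (star z * (x * z - z * x))‖ ≤ ε') (by
    intro s hs
    obtain ⟨y, hy1, hy2, hy3, hy4⟩ := exists_approx_unit_ker π
      (X ∪ ((s ×ˢ Z).image (fun p => p.1 * p.2 - p.2 * p.1) ∪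
        (s ×ˢ Z).image (fun p => star p.2 * (p.1 * p.2 - p.2 * p.1)))) (by
      intro x hx
      simp only [Finset.mem_union, Finset.mem_image, Finset.mem_product, Prod.exists] at hx
      rcases hx with hx | ⟨a, b, ⟨ha, -⟩, rfl⟩ | ⟨a, b, ⟨ha, -⟩, rfl⟩
      · exact hX x hx
      · simp [(hs a ha).2.2.1]
      · simp [(hs a ha).2.2.1]) hε'0
    refine ⟨y, ⟨hy1, hy2, hy3, fun x hx => hy4 x (Finset.mem_union_left _ hx)⟩,
      fun x hx z hz => ⟨hy4 _ ?_, hy4 _ ?_⟩⟩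
    · exact Finset.mem_union_right _ (Finset.mem_union_left _
        (Finset.mem_image.2 ⟨(x, z), Finset.mk_mem_product hx hz, rfl⟩))
    · exact Finset.mem_union_right _ (Finset.mem_union_right _
        (Finset.mem_image.2 ⟨(x, z), Finset.mk_mem_product hx hz, rfl⟩)))
  obtain ⟨n, hn⟩ := exists_nat_gt ((2 * M) ^ 2 / ε)
  have hn0 : (0 : ℝ) < n := lt_of_le_of_lt (by positivity) hn
  set s : A := ∑ k ∈ Finset.range n, u k with hs
  have hsc : ∀ z ∈ Z, ‖s * z - z * s‖ < n * δ := by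
    intro z hz
    have hz' := hM z hz
    have e : s * z - z * s = ∑ k ∈ Finset.range n, (u k * z - z * u k) := by
      rw [hs, Finset.sum_mul, Finset.mul_sum, Finset.sum_sub_distrib]
    have hbd := norm_sum_sq_le_of_almost_orthogonal (fun k => u k * z - z * u k) (M := 2 * M)
      (ε := ε) (fun k => (norm_sub_le_of_le (norm_mul_le_of_le_one_left (hu k).2.1 hz')
        (norm_mul_le_of_le_one_right (hu k).2.1 hz')).trans_eq (by ring)) hε0.le (by
        intro j k hjk
        obtain ⟨h1, h2⟩ := hr j k hjk z hz
        set c := u j * z - z * u j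
        have e2 : star c * (u k * z - z * u k)
            = star ((1 - u k) * (star z * c)) - star ((1 - u k) * c) * z := by
          simp only [star_mul, star_sub, star_one, (hu k).1.star_eq, star_star]
          noncomm_ring
        have h3 : ε' * (M + 1) ≤ ε := by
          rw [← le_div_iff₀ (by positivity)]; exact min_le_right _ _
        calc ‖star c * (u k * z - z * u k)‖ ≤ ε' + ε' * M := by
              rw [e2]
              exact norm_sub_le_of_le (by rwa [norm_star])
                (norm_mul_le_of_le (by rwa [norm_star]) hz')
          _ ≤ ε := by linarith) n
    rw [← e] at hbd
    have h4 : (n : ℝ) * (2 * M) ^ 2 + n ^ 2 * ε < (n * δ) ^ 2 := by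
      rw [div_lt_iff₀ hε0] at hn
      have : (n : ℝ) * (2 * M) ^ 2 ≤ n * (n * ε) := by gcongr
      have h5 : (n * δ) ^ 2 = 4 * (n ^ 2 * ε) := by rw [hε]; ring
      have : 0 < (n : ℝ) ^ 2 * ε := by positivity
      nlinarith
    exact lt_of_pow_lt_pow_left₀ 2 (by positivity) (hbd.trans_lt h4)
  refine ⟨(n : ℝ)⁻¹ • s, ?_, ?_, ?_, fun z hz => ?_, fun x hx => ?_⟩
  · refine IsSelfAdjoint.smul (IsSelfAdjoint.all _) ?_
    rw [IsSelfAdjoint, hs, star_sum]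
    exact Finset.sum_congr rfl fun k _ => (hu k).1.star_eq
  · rw [norm_smul, Real.norm_of_nonneg (by positivity), inv_mul_le_iff₀ hn0, mul_one]
    exact (norm_sum_le_of_le _ fun k _ => (hu k).2.1).trans_eq (by simp)
  · rw [← Complex.coe_smul, map_smul, hs, map_sum,
      Finset.sum_eq_zero fun k _ => (hu k).2.2.1, smul_zero]
  · rw [smul_mul_assoc, mul_smul_comm, ← smul_sub, norm_smul,
      Real.norm_of_nonneg (by positivity), inv_mul_lt_iff₀ hn0]
    exact hsc z hz
  · have e : (1 - (n : ℝ)⁻¹ • s) * x = (n : ℝ)⁻¹ • ∑ k ∈ Finset.range n, (1 - u k) * x := by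
      rw [← Finset.sum_mul, Finset.sum_sub_distrib, ← hs, Finset.sum_const, Finset.card_range,
        ← smul_mul_assoc, smul_sub, ← Nat.cast_smul_eq_nsmul ℝ, smul_smul,
        inv_mul_cancel₀ hn0.ne', one_smul]
    rw [e, norm_smul, Real.norm_of_nonneg (by positivity), inv_mul_lt_iff₀ hn0]
    calc ‖∑ k ∈ Finset.range n, (1 - u k) * x‖ ≤ n * (δ / 2) :=
          (norm_sum_le_of_le _ fun k _ => ((hu k).2.2.2 x hx).trans (min_le_left _ _)).trans_eq
            (by simp)
      _ < n * δ := by nlinarith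

end QuasiCentral

section Selection

variable {A Q : Type*} [CStarAlgebra A] [CStarAlgebra Q]

lemma norm_convex_comb_lt {E : Type*} [NormedAddCommGroup E] [NormedSpace ℝ E] {x y : E} {δ a b : ℝ}
    (hx : ‖x‖ < δ) (hy : ‖y‖ < δ) (ha : 0 ≤ a) (hb : 0 ≤ b) (hab : a + b = 1) :
    ‖a • x + b • y‖ < δ := by
  have := convex_ball (0 : E) δ (by simpa using hx) (by simpa using hy) ha hb hab
  simpa using this

/-- A continuous choice of quasicentral elements of the kernel of `π`, which is allowed to be `1`
where `ρ` is small. -/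
lemma exists_continuous_quasicentral {T κ : Type*} [TopologicalSpace T] [NormalSpace T]
    [ParacompactSpace T] [Finite κ] (π : A →⋆ₐ[ℂ] Q) (Z X : ℕ → κ → T → A)
    (hZ : ∀ n k, Continuous (Z n k)) (hX : ∀ n k, Continuous (X n k))
    (hπX : ∀ n k t, π (X n k t) = 0) {ρ : T → ℝ} (hρ : Continuous ρ) (δ : ℕ → T → ℝ)
    (hδc : ∀ n, Continuous (δ n)) (hδ : ∀ n t, 0 < δ n t) (m : ℝ) :
    ∃ h : T → A, Continuous h ∧ ∀ t, IsSelfAdjoint (h t) ∧ ‖h t‖ ≤ 1 ∧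
      (∃ c : ℝ, π (h t) = algebraMap ℝ Q c) ∧ (m ≤ ρ t → π (h t) = 0) ∧ (ρ t ≤ m - 1 → h t = 1) ∧
      ∀ n : ℕ, n ≤ ρ t → ∀ k, ‖h t * Z n k t - Z n k t * h t‖ < δ n t ∧
        ‖(1 - h t) * X n k t‖ < δ n t := by
  classical
  cases nonempty_fintype κ
  let K : T → Set A := fun t => {h | IsSelfAdjoint h ∧ ‖h‖ ≤ 1 ∧
      (∃ c : ℝ, π h = algebraMap ℝ Q c) ∧ (m ≤ ρ t → π h = 0) ∧ (ρ t ≤ m - 1 → h = 1) ∧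
      ∀ n : ℕ, n ≤ ρ t → ∀ k, ‖h * Z n k t - Z n k t * h‖ < δ n t ∧
        ‖(1 - h) * X n k t‖ < δ n t}
  have hsmul : ∀ (a : ℝ) (x : A), π (a • x) = a • π x := fun a x => by
    rw [← Complex.coe_smul, map_smul, Complex.coe_smul]
  have hK : ∀ t, Convex ℝ (K t) := by
    rintro t x ⟨x1, x2, ⟨c, x3⟩, x4, x5, x6⟩ y ⟨y1, y2, ⟨d, y3⟩, y4, y5, y6⟩ a b ha hb hab
    refine ⟨?_, ?_, ⟨a * c + b * d, ?_⟩, fun h => ?_, fun h => ?_, fun n hn k => ⟨?_, ?_⟩⟩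
    · exact (IsSelfAdjoint.smul (IsSelfAdjoint.all a) x1).add
        (IsSelfAdjoint.smul (IsSelfAdjoint.all b) y1)
    · have := convex_closedBall (0 : A) 1 (by simpa using x2) (by simpa using y2) ha hb hab
      simpa using this
    · rw [map_add, hsmul, hsmul, x3, y3, map_add, map_mul, map_mul, Algebra.smul_def,
        Algebra.smul_def]
    · rw [map_add, hsmul, hsmul, x4 h, y4 h, smul_zero, smul_zero, add_zero]
    · rw [x5 h, y5 h, ← add_smul, hab, one_smul]
    · have e : (a • x + b • y) * Z n k t - Z n k t * (a • x + b • y)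
          = a • (x * Z n k t - Z n k t * x) + b • (y * Z n k t - Z n k t * y) := by
        simp only [add_mul, mul_add, smul_mul_assoc, mul_smul_comm, smul_sub]; abel
      rw [e]
      exact norm_convex_comb_lt (x6 n hn k).1 (y6 n hn k).1 ha hb hab
    · have e : (1 - (a • x + b • y)) * X n k t
          = a • ((1 - x) * X n k t) + b • ((1 - y) * X n k t) := by
        have : (1 : A) = a • (1 : A) + b • (1 : A) := by rw [← add_smul, hab, one_smul]
        rw [← smul_mul_assoc, ← smul_mul_assoc, ← add_mul]
        congr 1
        conv_lhs => rw [this]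
        rw [smul_sub, smul_sub]; abel
      rw [e]
      exact norm_convex_comb_lt (x6 n hn k).2 (y6 n hn k).2 ha hb hab
  obtain ⟨g, hg⟩ := exists_continuous_forall_mem_convex_of_local_const (t := K) hK (by
    intro t
    have hρ1 : ∀ᶠ s in 𝓝 t, ρ s < ρ t + 1 := hρ.continuousAt.eventually_lt_const (by linarith)
    rcases lt_or_ge (ρ t) m with ht | ht
    · refine ⟨1, ?_⟩
      filter_upwards [hρ.continuousAt.eventually_lt_const ht] with s hs
      refine ⟨IsSelfAdjoint.one A, ?_, ⟨1, by simp⟩, fun h => absurd h hs.not_ge, fun _ => rfl,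
        fun n _ k => ⟨by simpa using hδ n s, by simpa using hδ n s⟩⟩
      cases subsingleton_or_nontrivial A
      · simp [Subsingleton.elim (1 : A) 0]
      · exact CStarRing.norm_one.le
    · obtain ⟨N, hN⟩ := exists_nat_ge (ρ t + 1)
      obtain ⟨ε, hε0, hε⟩ : ∃ ε : ℝ, 0 < ε ∧ ∀ n ∈ Finset.range (N + 1), ε ≤ δ n t :=
        ⟨(Finset.range (N + 1)).inf' ⟨0, by simp⟩ (fun n => δ n t),
          (Finset.lt_inf'_iff _).2 fun n _ => hδ n t, fun n hn => Finset.inf'_le _ hn⟩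
      obtain ⟨h, h1, h2, h3, h4, h5⟩ := exists_quasicentral_ker π
        ((Finset.range (N + 1) ×ˢ (Finset.univ : Finset κ)).image fun p => Z p.1 p.2 t)
        ((Finset.range (N + 1) ×ˢ (Finset.univ : Finset κ)).image fun p => X p.1 p.2 t) (by
          intro x hx
          obtain ⟨p, -, rfl⟩ := Finset.mem_image.1 hx
          exact hπX _ _ _) hε0
      refine ⟨h, ?_⟩
      have hev : ∀ᶠ s in 𝓝 t, ∀ p ∈ Finset.range (N + 1) ×ˢ (Finset.univ : Finset κ),
          ‖h * Z p.1 p.2 s - Z p.1 p.2 s * h‖ < δ p.1 s ∧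
          ‖(1 - h) * X p.1 p.2 s‖ < δ p.1 s := by
        rw [Filter.eventually_all_finset]
        intro p hp
        have hp1 := (Finset.mem_product.1 hp).1
        have cZ := hZ p.1 p.2
        have cX := hX p.1 p.2
        refine (Filter.Tendsto.eventually_lt (Continuous.tendsto (by fun_prop) t)
          ((hδc p.1).tendsto t) ?_).and (Filter.Tendsto.eventually_lt
            (Continuous.tendsto (by fun_prop) t) ((hδc p.1).tendsto t) ?_)
        · exact (h4 _ (Finset.mem_image.2 ⟨p, hp, rfl⟩)).trans_le (hε _ hp1)
        · exact (h5 _ (Finset.mem_image.2 ⟨p, hp, rfl⟩)).trans_le (hε _ hp1)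
      filter_upwards [hρ1, hev, hρ.continuousAt.eventually_const_lt (show m - 1 < ρ t by linarith)]
        with s hs hs2 hs3
      refine ⟨h1, h2, ⟨0, by simpa using h3⟩, fun _ => h3, fun h' => absurd h' hs3.not_ge,
        fun n hn k => hs2 (n, k) (Finset.mk_mem_product ?_ (Finset.mem_univ k))⟩
      rw [Finset.mem_range, Nat.lt_succ_iff, ← Nat.cast_le (α := ℝ)]
      linarith)
  exact ⟨g, g.continuous, fun t => hg t⟩

end Selection

section ContinuousSection

variable {E F : Type*} [NormedAddCommGroup E] [NormedSpace ℝ E] [CompleteSpace E]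
  [NormedAddCommGroup F] [NormedSpace ℝ F] [CompleteSpace F]

/-- **Bartle–Graves theorem**: a surjective bounded operator between Banach spaces has a continuous
(not necessarily linear) right inverse. -/
theorem exists_continuous_rightInverse (q : E →L[ℝ] F) (hq : Function.Surjective q) :
    ∃ σ : F → E, Continuous σ ∧ (∀ y, q (σ y) = y) ∧ σ 0 = 0 := by
  obtain ⟨C, hC0, hC⟩ := q.exists_preimage_norm_le hq
  have step : ∀ (f : C(F, F)) (ε : ℝ), 0 < ε → ∃ g : C(F, E), ∀ x,
      ‖f x - q (g x)‖ < ε ∧ ‖g x‖ < C * ‖f x‖ + ε := by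
    intro f ε hε
    refine exists_continuous_forall_mem_convex_of_local_const
      (t := fun x => {e : E | ‖f x - q e‖ < ε ∧ ‖e‖ < C * ‖f x‖ + ε}) ?_ ?_
    · rintro x e ⟨he1, he2⟩ e' ⟨he1', he2'⟩ a b ha hb hab
      refine ⟨?_, norm_convex_comb_lt he2 he2' ha hb hab⟩
      have : f x - q (a • e + b • e') = a • (f x - q e) + b • (f x - q e') := by
        have h1 : f x = a • f x + b • f x := by rw [← add_smul, hab, one_smul]
        rw [map_add, map_smul, map_smul, smul_sub, smul_sub]
        conv_lhs => rw [h1]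
        abel
      rw [this]
      exact norm_convex_comb_lt he1 he1' ha hb hab
    · intro x
      obtain ⟨e, he, hen⟩ := hC (f x)
      refine ⟨e, ?_⟩
      have hf := f.continuous
      refine (Filter.Tendsto.eventually_lt_const (u := ε) ?_
        (Continuous.tendsto (by fun_prop) x)).and
        (Filter.Tendsto.eventually_const_lt (u := ‖e‖) ?_ (Continuous.tendsto (by fun_prop) x))
      · simpa [he] using hε
      · linarith
  choose! G hG1 hG2 using step
  let ε : ℕ → ℝ := fun n => (1 / 2) ^ n
  have hε : ∀ n, 0 < ε n := fun n => by positivity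
  let f : ℕ → C(F, F) := fun n => Nat.rec (ContinuousMap.id F)
    (fun n f => f - (⟨q, q.continuous⟩ : C(E, F)).comp (G f (ε n))) n
  have hf : ∀ n y, f (n + 1) y = f n y - q (G (f n) (ε n) y) := fun n y => rfl
  let g : ℕ → C(F, E) := fun n => G (f n) (ε n)
  have hfn : ∀ n y, ‖f (n + 1) y‖ ≤ ε n := fun n y => by
    rw [hf]; exact (hG1 (f n) (ε n) (hε n) y).le
  have hgn : ∀ n y, ‖g (n + 1) y‖ ≤ (C + 1) * ε n := fun n y => by
    have h1 := hG2 (f (n + 1)) (ε (n + 1)) (hε _) y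
    have h2 : ε (n + 1) ≤ ε n := pow_le_pow_of_le_one (by norm_num) (by norm_num) n.le_succ
    have h3 := mul_le_mul_of_nonneg_left (hfn n y) hC0.le
    change ‖G (f (n + 1)) (ε (n + 1)) y‖ ≤ _
    linarith
  have hsum : Summable fun n => (C + 1) * ε n :=
    (summable_geometric_of_lt_one (by norm_num) (by norm_num)).mul_left _
  have hcont : Continuous fun y => ∑' n, g (n + 1) y :=
    continuous_tsum (fun n => (g (n + 1)).continuous) hsum hgn
  let τ : F → E := fun y => g 0 y + ∑' n, g (n + 1) y
  have hτ : ∀ y, q (τ y) = y := by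
    intro y
    have hs : HasSum (fun n => g (n + 1) y) (∑' n, g (n + 1) y) :=
      (Summable.of_norm_bounded hsum fun n => hgn n y).hasSum
    have h1 : Tendsto (fun n => q (g 0 y + ∑ k ∈ Finset.range n, g (k + 1) y)) atTop
        (𝓝 (q (τ y))) :=
      (q.continuous.tendsto _).comp (tendsto_const_nhds.add hs.tendsto_sum_nat)
    have h2 : ∀ n, q (g 0 y + ∑ k ∈ Finset.range n, g (k + 1) y) = y - f (n + 1) y := by
      intro n
      induction n with
      | zero =>
        have : f 0 y = y := rfl
        simp [hf, g, this]
      | succ n ih =>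
        rw [Finset.sum_range_succ, ← add_assoc, map_add, ih, hf (n + 1)]
        change y - f (n + 1) y + q (G (f (n + 1)) (ε (n + 1)) y) = _
        abel
    have h3 : Tendsto (fun n => f (n + 1) y) atTop (𝓝 0) :=
      squeeze_zero_norm (fun n => hfn n y)
        (tendsto_pow_atTop_nhds_zero_of_lt_one (by norm_num) (by norm_num))
    have h4 : Tendsto (fun n => y - f (n + 1) y) atTop (𝓝 (y - 0)) := tendsto_const_nhds.sub h3
    rw [sub_zero] at h4
    exact tendsto_nhds_unique (by simpa only [h2] using h1) h4
  refine ⟨fun y => τ y - τ 0, ?_, fun y => ?_, sub_self _⟩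
  · exact (((g 0).continuous.add hcont).sub continuous_const)
  · rw [map_sub, hτ, hτ, sub_zero]

end ContinuousSection

section Compression

variable {A Q : Type*} [CStarAlgebra A] [CStarAlgebra Q]

lemma map_ringInverse_one_add_mul_self (π : A →⋆ₐ[ℂ] Q) {h : A} (hh : IsSelfAdjoint h) :
    π (Ring.inverse (1 + h * h)) = Ring.inverse (1 + π h * π h) := by
  have hu := isUnit_one_add_mul_self hh
  have hu' := isUnit_one_add_mul_self (hh.map π)
  have h1 := congrArg π (Ring.inverse_mul_cancel _ hu)
  simp only [map_mul, map_add, map_one] at h1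
  calc π (Ring.inverse (1 + h * h))
      = π (Ring.inverse (1 + h * h)) * ((1 + π h * π h) * Ring.inverse (1 + π h * π h)) := by
        rw [Ring.mul_inverse_cancel _ hu', mul_one]
    _ = Ring.inverse (1 + π h * π h) := by rw [← mul_assoc, h1, one_mul]

lemma map_cayleySin (π : A →⋆ₐ[ℂ] Q) {h : A} (hh : IsSelfAdjoint h) :
    π (cayleySin h) = cayleySin (π h) := by
  simp [cayleySin, map_ofNat π 2, map_ringInverse_one_add_mul_self π hh]

lemma map_cayleyCos (π : A →⋆ₐ[ℂ] Q) {h : A} (hh : IsSelfAdjoint h) :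
    π (cayleyCos h) = cayleyCos (π h) := by
  simp [cayleyCos, map_ofNat π 2, map_ringInverse_one_add_mul_self π hh]

lemma cayleySin_zero : cayleySin (0 : A) = 0 := by simp [cayleySin]

lemma cayleyCos_zero : cayleyCos (0 : A) = 1 := by
  simp only [cayleyCos, mul_zero, add_zero, Ring.inverse_one, mul_one]
  norm_num

lemma cayleyCos_one : cayleyCos (1 : A) = 0 := by
  have h := Ring.mul_inverse_cancel _ (isUnit_one_add_mul_self (IsSelfAdjoint.one A))
  rw [mul_one, one_add_one_eq_two] at h
  rw [cayleyCos, mul_one, one_add_one_eq_two, h, sub_self]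

lemma cayleySin_one : cayleySin (1 : A) = 1 := by
  have h := Ring.mul_inverse_cancel _ (isUnit_one_add_mul_self (IsSelfAdjoint.one A))
  rw [mul_one, one_add_one_eq_two] at h
  rw [cayleySin, mul_one, one_mul, one_add_one_eq_two, h]

lemma continuous_ringInverse_one_add_mul_self {T : Type*} [TopologicalSpace T] {h : T → A}
    (hc : Continuous h) (hh : ∀ t, IsSelfAdjoint (h t)) :
    Continuous fun t => Ring.inverse (1 + h t * h t) := by
  refine continuous_iff_continuousAt.2 fun t => ?_
  have hi := NormedRing.inverse_continuousAt (isUnit_one_add_mul_self (hh t)).unit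
  exact ContinuousAt.comp (f := fun t => 1 + h t * h t) hi
    (continuous_const.add (hc.mul hc)).continuousAt

lemma continuous_cayleySin {T : Type*} [TopologicalSpace T] {h : T → A}
    (hc : Continuous h) (hh : ∀ t, IsSelfAdjoint (h t)) : Continuous fun t => cayleySin (h t) :=
  continuous_const.mul (hc.mul (continuous_ringInverse_one_add_mul_self hc hh))

lemma continuous_cayleyCos {T : Type*} [TopologicalSpace T] {h : T → A}
    (hc : Continuous h) (hh : ∀ t, IsSelfAdjoint (h t)) : Continuous fun t => cayleyCos (h t) :=
  (continuous_const.mul (continuous_ringInverse_one_add_mul_self hc hh)).sub continuous_const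

/-- The unital completely positive compression `(x, y) ↦ v x v + w y w`, where `v + w i` is the
Cayley transform of `h`. -/
def cayleyMix (h x y : A) : A :=
  cayleySin h * x * cayleySin h + cayleyCos h * y * cayleyCos h

lemma cayleyMix_one (x y : A) : cayleyMix 1 x y = x := by
  simp [cayleyMix, cayleySin_one, cayleyCos_one]

lemma cayleyMix_zero (x y : A) : cayleyMix 0 x y = y := by
  simp [cayleyMix, cayleySin_zero, cayleyCos_zero]

lemma cayleyMix_algebraMap_self (c : ℝ) (x : A) : cayleyMix (algebraMap ℝ A c) x x = x := by
  have hh : IsSelfAdjoint (algebraMap ℝ A c) := by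
    rw [IsSelfAdjoint, ← algebraMap_star_comm, star_trivial]
  have hc : Commute (algebraMap ℝ A c) x := Algebra.commutes c x
  have hr : Commute (Ring.inverse (1 + algebraMap ℝ A c * algebraMap ℝ A c)) x := by
    have : Ring.inverse (1 + algebraMap ℝ A c * algebraMap ℝ A c)
        = algebraMap ℝ A ((1 + c * c)⁻¹) := by
      have hne : (1 + c * c : ℝ) ≠ 0 := (add_pos_of_pos_of_nonneg one_pos (mul_self_nonneg c)).ne'
      have h1 := Ring.inverse_mul_cancel _ (isUnit_one_add_mul_self hh)
      rw [← map_mul, ← map_one (algebraMap ℝ A), ← map_add] at h1 ⊢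
      calc _ = Ring.inverse (algebraMap ℝ A (1 + c * c))
            * algebraMap ℝ A ((1 + c * c) * (1 + c * c)⁻¹) := by
              rw [mul_inv_cancel₀ hne, map_one, mul_one]
        _ = _ := by rw [map_mul, ← mul_assoc, h1, map_one, one_mul]
    rw [this]
    exact Algebra.commutes _ x
  have h2 : Commute (2 : A) x := Commute.ofNat_left 2 x
  have hv : Commute (cayleySin (algebraMap ℝ A c)) x := h2.mul_left (hc.mul_left hr)
  have hw : Commute (cayleyCos (algebraMap ℝ A c)) x :=
    (h2.mul_left hr).sub_left (Commute.one_left x)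
  rw [cayleyMix, hv.eq, hw.eq, mul_assoc, mul_assoc, ← mul_add, cayleySin_sq_add_cayleyCos_sq hh,
    mul_one]

lemma map_cayleyMix (π : A →⋆ₐ[ℂ] Q) {h : A} (hh : IsSelfAdjoint h) (x y : A) :
    π (cayleyMix h x y) = cayleyMix (π h) (π x) (π y) := by
  simp [cayleyMix, map_cayleySin π hh, map_cayleyCos π hh]

lemma cayleyMix_sub (h x y x' y' : A) :
    cayleyMix h x y - cayleyMix h x' y' = cayleyMix h (x - x') (y - y') := by
  simp only [cayleyMix]; noncomm_ring

lemma cayleyMix_add (h x y x' y' : A) :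
    cayleyMix h x y + cayleyMix h x' y' = cayleyMix h (x + x') (y + y') := by
  simp only [cayleyMix]; noncomm_ring

lemma cayleyMix_smul (h x y : A) (μ : ℂ) : μ • cayleyMix h x y = cayleyMix h (μ • x) (μ • y) := by
  simp [cayleyMix]

lemma star_cayleyMix {h : A} (hh : IsSelfAdjoint h) (x y : A) :
    star (cayleyMix h x y) = cayleyMix h (star x) (star y) := by
  simp [cayleyMix, (isSelfAdjoint_cayleySin hh).star_eq, (isSelfAdjoint_cayleyCos hh).star_eq,
    mul_assoc]

lemma norm_cayleyMix_le {h : A} (hh : IsSelfAdjoint h) (x y : A) :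
    ‖cayleyMix h x y‖ ≤ max ‖x‖ ‖y‖ :=
  norm_conj_add_conj_le (isSelfAdjoint_cayleySin hh) (isSelfAdjoint_cayleyCos hh)
    (cayleySin_mul_cayleyCos hh) (cayleySin_sq_add_cayleyCos_sq hh) (le_max_left _ _)
    (le_max_right _ _)

lemma norm_cayleySin_le {h : A} (hh : IsSelfAdjoint h) : ‖cayleySin h‖ ≤ 1 :=
  norm_le_one_of_mul_self_add_mul_self (isSelfAdjoint_cayleySin hh) (isSelfAdjoint_cayleyCos hh)
    (cayleySin_mul_cayleyCos hh) (cayleySin_sq_add_cayleyCos_sq hh)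

lemma norm_cayleyCos_le {h : A} (hh : IsSelfAdjoint h) : ‖cayleyCos h‖ ≤ 1 :=
  norm_le_one_of_mul_self_add_mul_self (isSelfAdjoint_cayleyCos hh) (isSelfAdjoint_cayleySin hh)
    (cayleySin_mul_cayleyCos hh).symm (by rw [add_comm, cayleySin_sq_add_cayleyCos_sq hh])

lemma norm_cayleyMix_le_add {h : A} (hh : IsSelfAdjoint h) (hn : ‖h‖ ≤ 1) {x y : A} {δ : ℝ}
    (hy : ‖(1 - h) * y‖ ≤ δ) : ‖cayleyMix h x y‖ ≤ ‖x‖ + 6 * δ :=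
  norm_add_le_of_le (norm_conj_le (norm_cayleySin_le hh) le_rfl)
    (norm_mul_le_of_le_one_right (norm_cayleyCos_le hh) (norm_cayleyCos_mul_le hh hn hy))

lemma norm_cayleyMix_mul_defect_le {h : A} (hh : IsSelfAdjoint h) (hn : ‖h‖ ≤ 1)
    {x x' x'' y y' y'' p : A} {M δ : ℝ} (hM : 1 ≤ M) (hx : ‖x‖ ≤ M) (hx' : ‖x'‖ ≤ M)
    (hy : ‖y‖ ≤ M) (hy' : ‖y'‖ ≤ M) (cx : ‖h * x - x * h‖ ≤ δ) (cx' : ‖h * x' - x' * h‖ ≤ δ)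
    (cy : ‖h * y - y * h‖ ≤ δ) (hdef : ‖(1 - h) * (y'' - y * y')‖ ≤ δ)
    (hp : ‖(1 - h) * ((x - y) * (x' - y') - p)‖ ≤ δ) :
    ‖cayleyMix h x'' y'' - cayleyMix h x y * cayleyMix h x' y'‖
      ≤ max ‖x'' - x * x'‖ ‖p‖ + 108 * M * δ := by
  refine (norm_conj_add_conj_mul_defect_le (isSelfAdjoint_cayleySin hh)
    (isSelfAdjoint_cayleyCos hh) (cayleySin_mul_cayleyCos hh) (cayleySin_sq_add_cayleyCos_sq hh)
    hM hx hx' hy hy' (norm_cayleySin_commutator_le hh hn cx)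
    (norm_cayleySin_commutator_le hh hn cx') (norm_cayleySin_commutator_le hh hn cy)
    (norm_cayleyCos_commutator_le hh hn cx) (norm_cayleyCos_commutator_le hh hn cx')
    (norm_cayleyCos_mul_le hh hn hdef) (norm_cayleyCos_mul_le hh hn hp)
    (le_max_left _ _) (le_max_right _ _)).trans_eq (by ring)

end Compression

section Step

variable {A B : Type*} [NonUnitalCStarAlgebra A] [NonUnitalCStarAlgebra B]

/-- The defect of linearity of a map at a combination of two elements. -/
def linDefect (G : B → A) (μ ν : ℂ) (a b : B) : A := G (μ • a + ν • b) - (μ • G a + ν • G b)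

/-- The defect of multiplicativity of a map at two elements. -/
def mulDefect (G : B → A) (a b : B) : A := G (a * b) - G a * G b

/-- The defect of a map to preserve the adjoint. -/
def starDefect (G : B → A) (a : B) : A := G (star a) - star (G a)

end Step

section Step

variable {A Q B T : Type*} [CStarAlgebra A] [CStarAlgebra Q] [NonUnitalCStarAlgebra B]
  [TopologicalSpace T]

/-- One small step of the homotopy: the family `G`, lifting `γ`, is compressed together with
an arbitrary set-theoretic lift `Y` of `γ'`, producing a lift of `γ'` whose defects are controlled
by those of `G` and by the distance from `γ` to `γ'`. -/
lemma exists_compressed_lift [NormalSpace T] [ParacompactSpace T] (π : A →⋆ₐ[ℂ] Q)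
    (σ : Q → A) (hσ : Continuous σ) (hπσ : ∀ x, π (σ x) = x)
    {ρ : T → ℝ} (hρ : Continuous ρ) (d : ℕ → (ℂ × ℂ) × B × B) {ε : T → ℝ} (hε : Continuous ε)
    (hε0 : ∀ t, 0 < ε t) (m : ℝ) (γ γ' : T → B →⋆ₙₐ[ℂ] Q)
    (hγ : ∀ t, ρ t < m → γ t = γ' t)
    (G Y : T → B → A) (hG : ∀ b, Continuous fun t => G t b) (hY : ∀ b, Continuous fun t => Y t b)
    (hπG : ∀ t b, π (G t b) = γ t b) (hπY : ∀ t b, π (Y t b) = γ' t b) :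
    ∃ G' : T → B → A, (∀ b, Continuous fun t => G' t b) ∧ (∀ t b, π (G' t b) = γ' t b) ∧
      (∀ t, ρ t ≤ m - 1 → G' t = G t) ∧
      (∀ t b b', ‖G' t b - G' t b'‖ ≤ max ‖G t b - G t b'‖ ‖Y t b - Y t b'‖) ∧
      (∀ t b, ‖G' t b‖ ≤ max ‖G t b‖ ‖Y t b‖) ∧
      ∀ t (n : ℕ), n ≤ ρ t →
        ‖linDefect (G' t) (d n).1.1 (d n).1.2 (d n).2.1 (d n).2.2‖
          ≤ ‖linDefect (G t) (d n).1.1 (d n).1.2 (d n).2.1 (d n).2.2‖ + ε t ∧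
        ‖starDefect (G' t) (d n).2.1‖ ≤ ‖starDefect (G t) (d n).2.1‖ + ε t ∧
        ‖mulDefect (G' t) (d n).2.1 (d n).2.2‖
          ≤ max ‖mulDefect (G t) (d n).2.1 (d n).2.2‖
            ‖σ ((γ t (d n).2.1 - γ' t (d n).2.1) * (γ t (d n).2.2 - γ' t (d n).2.2))‖ + ε t := by
  have hπc : Continuous π := AddMonoidHomClass.continuous_of_bound π 1 fun x => by
    simpa using NonUnitalStarAlgHom.norm_apply_le π x
  let P : ℕ → T → A := fun n t =>
    (G t (d n).2.1 - Y t (d n).2.1) * (G t (d n).2.2 - Y t (d n).2.2)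
  have hP : ∀ n, Continuous (P n) := fun n => ((hG _).sub (hY _)).mul ((hG _).sub (hY _))
  let Z : ℕ → Fin 4 → T → A := fun n => ![fun t => G t (d n).2.1, fun t => G t (d n).2.2,
    fun t => Y t (d n).2.1, fun t => Y t (d n).2.2]
  let X : ℕ → Fin 4 → T → A := fun n =>
    ![fun t => linDefect (Y t) (d n).1.1 (d n).1.2 (d n).2.1 (d n).2.2,
      fun t => starDefect (Y t) (d n).2.1, fun t => mulDefect (Y t) (d n).2.1 (d n).2.2,
      fun t => P n t - σ (π (P n t))]
  have hZ : ∀ n k, Continuous (Z n k) := by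
    intro n k
    fin_cases k
    exacts [hG _, hG _, hY _, hY _]
  have hX : ∀ n k, Continuous (X n k) := by
    intro n k
    fin_cases k
    exacts [(hY _).sub (((hY _).const_smul _).add ((hY _).const_smul _)), (hY _).sub (hY _).star,
      (hY _).sub ((hY _).mul (hY _)), (hP n).sub (hσ.comp (hπc.comp (hP n)))]
  have hπX : ∀ n k t, π (X n k t) = 0 := by
    intro n k t
    fin_cases k
    · simp [X, linDefect, hπY]
    · simp [X, starDefect, hπY, map_star]
    · simp [X, mulDefect, hπY]
    · simp [X, hπσ]
  let M : ℕ → T → ℝ := fun n t =>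
    1 + (‖G t (d n).2.1‖ + ‖G t (d n).2.2‖ + ‖Y t (d n).2.1‖ + ‖Y t (d n).2.2‖)
  have hM : ∀ n, Continuous (M n) := fun n => continuous_const.add
    ((((hG _).norm.add (hG _).norm).add (hY _).norm).add (hY _).norm)
  have hM1 : ∀ n t, 1 ≤ M n t := fun n t => by
    have : 0 ≤ ‖G t (d n).2.1‖ + ‖G t (d n).2.2‖ + ‖Y t (d n).2.1‖ + ‖Y t (d n).2.2‖ := by
      positivity
    simp only [M]; linarith
  have hM0 : ∀ n t, 0 < 108 * M n t := fun n t => by linarith [hM1 n t]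
  obtain ⟨h, hc, hh⟩ := exists_continuous_quasicentral π Z X hZ hX hπX hρ
    (fun n t => ε t / (108 * M n t)) (fun n => hε.div (continuous_const.mul (hM n))
      fun t => (hM0 n t).ne') (fun n t => div_pos (hε0 t) (hM0 n t)) m
  have hsa : ∀ t, IsSelfAdjoint (h t) := fun t => (hh t).1
  have hn : ∀ t, ‖h t‖ ≤ 1 := fun t => (hh t).2.1
  refine ⟨fun t b => cayleyMix (h t) (G t b) (Y t b), fun b => ?_, fun t b => ?_, fun t ht => ?_,
    fun t b b' => ?_, fun t b => norm_cayleyMix_le (hsa t) _ _, fun t n hnt => ?_⟩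
  · have hs := continuous_cayleySin hc hsa
    have hcos := continuous_cayleyCos hc hsa
    exact ((hs.mul (hG b)).mul hs).add ((hcos.mul (hY b)).mul hcos)
  · rw [map_cayleyMix π (hsa t), hπG, hπY]
    rcases lt_or_ge (ρ t) m with hlt | hge
    · obtain ⟨c, hcc⟩ := (hh t).2.2.1
      rw [hγ t hlt, hcc, cayleyMix_algebraMap_self]
    · rw [(hh t).2.2.2.1 hge, cayleyMix_zero]
  · funext b
    simp only [(hh t).2.2.2.2.1 ht, cayleyMix_one]
  · rw [cayleyMix_sub]
    exact norm_cayleyMix_le (hsa t) _ _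
  · have key := (hh t).2.2.2.2.2 n hnt
    set δ := ε t / (108 * M n t) with hδ
    have hδM : 108 * M n t * δ = ε t := mul_div_cancel₀ _ (hM0 n t).ne'
    have hδ0 : 0 < δ := div_pos (hε0 t) (hM0 n t)
    have hδε : 6 * δ ≤ ε t := by
      rw [← hδM]
      exact mul_le_mul_of_nonneg_right (by linarith [hM1 n t]) hδ0.le
    have hdef : ∀ k, ‖(1 - h t) * X n k t‖ ≤ δ := fun k => (key k).2.le
    have hcomm : ∀ k, ‖h t * Z n k t - Z n k t * h t‖ ≤ δ := fun k => (key k).1.le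
    refine ⟨?_, ?_, ?_⟩
    · have := norm_cayleyMix_le_add (hsa t) (hn t)
        (x := linDefect (G t) (d n).1.1 (d n).1.2 (d n).2.1 (d n).2.2) (hdef 0)
      refine (le_of_eq ?_).trans (this.trans (by gcongr))
      simp only [linDefect, cayleyMix_smul, cayleyMix_add, cayleyMix_sub]
      rfl
    · have := norm_cayleyMix_le_add (hsa t) (hn t) (x := starDefect (G t) (d n).2.1) (hdef 1)
      refine (le_of_eq ?_).trans (this.trans (by gcongr))
      simp only [starDefect, star_cayleyMix (hsa t), cayleyMix_sub]
      rfl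
    · have hbd : ‖G t (d n).2.1‖ ≤ M n t ∧ ‖G t (d n).2.2‖ ≤ M n t ∧ ‖Y t (d n).2.1‖ ≤ M n t ∧
          ‖Y t (d n).2.2‖ ≤ M n t := by
        have h1 := norm_nonneg (G t (d n).2.1)
        have h2 := norm_nonneg (G t (d n).2.2)
        have h3 := norm_nonneg (Y t (d n).2.1)
        have h4 := norm_nonneg (Y t (d n).2.2)
        simp only [M]
        refine ⟨?_, ?_, ?_, ?_⟩ <;> linarith
      have := norm_cayleyMix_mul_defect_le (hsa t) (hn t) (hM1 n t) hbd.1 hbd.2.1 hbd.2.2.1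
        hbd.2.2.2 (hcomm 0) (hcomm 1) (hcomm 2)
        (x'' := G t ((d n).2.1 * (d n).2.2)) (hdef 2) (hdef 3)
      rw [hδM] at this
      have e : π (P n t) = (γ t (d n).2.1 - γ' t (d n).2.1) * (γ t (d n).2.2 - γ' t (d n).2.2) := by
        simp [P, hπG, hπY]
      rw [e] at this
      exact this

end Step

section Iteration

variable {A Q B T : Type*} [CStarAlgebra A] [CStarAlgebra Q] [NonUnitalCStarAlgebra B]
  [TopologicalSpace T]

lemma exists_seq_of_step {α : Type*} (p : ℕ → α → Prop) (r : ℕ → α → α → Prop) {x₀ : α}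
    (h₀ : p 0 x₀) (hstep : ∀ i x, p i x → ∃ y, p (i + 1) y ∧ r i x y) :
    ∃ x : ℕ → α, x 0 = x₀ ∧ ∀ i, p i (x i) ∧ r i (x i) (x (i + 1)) := by
  choose! f hf using hstep
  let x : ∀ i, {y : α // p i y} := fun i =>
    Nat.rec ⟨x₀, h₀⟩ (fun i y => ⟨f i y, (hf i y y.2).1⟩) i
  exact ⟨fun i => (x i).1, rfl, fun i => ⟨(x i).2, (hf i (x i).1 (x i).2).2⟩⟩

/-- Iteration of `exists_compressed_lift` along a chain `γ 0, γ 1, …` of homomorphisms which, over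
each point of the base, is eventually constant. -/
lemma exists_iterated_compressed_lift [NormalSpace T] [ParacompactSpace T] (π : A →⋆ₐ[ℂ] Q)
    (σ : Q → A) (hσ : Continuous σ) (hπσ : ∀ x, π (σ x) = x)
    {ρ : T → ℝ} (hρ : Continuous ρ) (d : ℕ → (ℂ × ℂ) × B × B) {ε : ℕ → T → ℝ}
    (hε : ∀ i, Continuous (ε i)) (hε0 : ∀ i t, 0 < ε i t) {e : T → ℝ}
    (he : ∀ N t, ∑ i ∈ Finset.range N, ε i t ≤ e t) (γ : ℕ → T → B →⋆ₙₐ[ℂ] Q)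
    (γ' : B →⋆ₙₐ[ℂ] Q) (hγ : ∀ (i : ℕ) t, ρ t + 1 ≤ i → γ i t = γ')
    (F : T → B → A) (Y : ℕ → T → B → A) (hF : ∀ b, Continuous fun t => F t b)
    (hY : ∀ i b, Continuous fun t => Y i t b)
    (hπF : ∀ t b, π (F t b) = γ 0 t b) (hπY : ∀ i t b, π (Y i t b) = γ i t b) :
    ∃ H : T → B → A, (∀ b, Continuous fun t => H t b) ∧ (∀ t b, π (H t b) = γ' b) ∧
      (∀ t b b' C, ‖F t b - F t b'‖ ≤ C → (∀ i, ‖Y i t b - Y i t b'‖ ≤ C) →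
        ‖H t b - H t b'‖ ≤ C) ∧
      (∀ t b C, ‖F t b‖ ≤ C → (∀ i, ‖Y i t b‖ ≤ C) → ‖H t b‖ ≤ C) ∧
      ∀ t (n : ℕ), n ≤ ρ t →
        ‖linDefect (H t) (d n).1.1 (d n).1.2 (d n).2.1 (d n).2.2‖
          ≤ ‖linDefect (F t) (d n).1.1 (d n).1.2 (d n).2.1 (d n).2.2‖ + e t ∧
        ‖starDefect (H t) (d n).2.1‖ ≤ ‖starDefect (F t) (d n).2.1‖ + e t ∧
        ∀ C, ‖mulDefect (F t) (d n).2.1 (d n).2.2‖ ≤ C →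
          (∀ i, ‖σ ((γ i t (d n).2.1 - γ (i + 1) t (d n).2.1)
            * (γ i t (d n).2.2 - γ (i + 1) t (d n).2.2))‖ ≤ C) →
          ‖mulDefect (H t) (d n).2.1 (d n).2.2‖ ≤ C + e t := by
  obtain ⟨G, hG0, hG⟩ := exists_seq_of_step
    (p := fun i (G : T → B → A) =>
      (∀ b, Continuous fun t => G t b) ∧ ∀ t b, π (G t b) = γ i t b)
    (r := fun i G G' =>
      (∀ t, ρ t ≤ ((i : ℝ) - 1) - 1 → G' t = G t) ∧
      (∀ t b b', ‖G' t b - G' t b'‖ ≤ max ‖G t b - G t b'‖ ‖Y (i + 1) t b - Y (i + 1) t b'‖) ∧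
      (∀ t b, ‖G' t b‖ ≤ max ‖G t b‖ ‖Y (i + 1) t b‖) ∧
      ∀ t (n : ℕ), n ≤ ρ t →
        ‖linDefect (G' t) (d n).1.1 (d n).1.2 (d n).2.1 (d n).2.2‖
          ≤ ‖linDefect (G t) (d n).1.1 (d n).1.2 (d n).2.1 (d n).2.2‖ + ε i t ∧
        ‖starDefect (G' t) (d n).2.1‖ ≤ ‖starDefect (G t) (d n).2.1‖ + ε i t ∧
        ‖mulDefect (G' t) (d n).2.1 (d n).2.2‖
          ≤ max ‖mulDefect (G t) (d n).2.1 (d n).2.2‖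
            ‖σ ((γ i t (d n).2.1 - γ (i + 1) t (d n).2.1)
              * (γ i t (d n).2.2 - γ (i + 1) t (d n).2.2))‖ + ε i t)
    (x₀ := F) ⟨hF, hπF⟩ (by
      rintro i G ⟨hGc, hGπ⟩
      obtain ⟨G', h1, h2, h3⟩ := exists_compressed_lift π σ hσ hπσ hρ d (hε i) (hε0 i)
        ((i : ℝ) - 1) (γ i) (γ (i + 1))
        (fun t ht => by
          rw [hγ i t (by linarith), hγ (i + 1) t (by push_cast; linarith)])
        G (Y (i + 1)) hGc (hY _) hGπ (hπY _)
      exact ⟨G', ⟨h1, h2⟩, h3⟩)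
  have hstable : ∀ t (i j : ℕ), ρ t + 2 ≤ i → i ≤ j → G j t = G i t := by
    intro t i j hi hij
    induction j, hij using Nat.le_induction with
    | base => rfl
    | succ j hij ih =>
      have : (i : ℝ) ≤ j := by exact_mod_cast hij
      rw [(hG j).2.1 t (by linarith), ih]
  let N : T → ℕ := fun t => ⌈ρ t⌉₊ + 2
  have hN : ∀ t, ρ t + 2 ≤ N t := fun t => by
    have := Nat.le_ceil (ρ t)
    simp only [N]; push_cast; linarith
  refine ⟨fun t => G (N t) t, fun b => ?_, fun t b => ?_, fun t b b' C h0 hYC => ?_,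
    fun t b C h0 hYC => ?_, fun t n hn => ?_⟩
  · refine continuous_iff_continuousAt.2 fun t₀ => ?_
    have hnear : ∀ᶠ t in 𝓝 t₀, ρ t < ρ t₀ + 1 :=
      hρ.continuousAt.eventually_lt continuousAt_const (by simp)
    refine ((hG (N t₀ + 1)).1.1 b).continuousAt.congr ?_
    filter_upwards [hnear] with t ht
    have h1 : ρ t + 2 ≤ ((N t₀ + 1 : ℕ) : ℝ) := by
      have := hN t₀
      push_cast; linarith
    rcases le_total (N t) (N t₀ + 1) with h | h
    · rw [hstable t _ _ (hN t) h]
    · rw [hstable t _ _ h1 h]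
  · rw [(hG (N t)).1.2, hγ _ _ (by linarith [hN t])]
  · suffices ∀ i, ‖G i t b - G i t b'‖ ≤ C from this _
    intro i
    induction i with
    | zero => rwa [hG0]
    | succ i ih => exact ((hG i).2.2.1 t b b').trans (max_le ih (hYC _))
  · suffices ∀ i, ‖G i t b‖ ≤ C from this _
    intro i
    induction i with
    | zero => rwa [hG0]
    | succ i ih => exact ((hG i).2.2.2.1 t b).trans (max_le ih (hYC _))
  · refine ⟨?_, ?_, fun C h0 hC => ?_⟩
    · suffices ∀ i, ‖linDefect (G i t) (d n).1.1 (d n).1.2 (d n).2.1 (d n).2.2‖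
          ≤ ‖linDefect (F t) (d n).1.1 (d n).1.2 (d n).2.1 (d n).2.2‖
            + ∑ j ∈ Finset.range i, ε j t from
        (this _).trans (by gcongr; exact he _ _)
      intro i
      induction i with
      | zero => simp [hG0]
      | succ i ih =>
        rw [Finset.sum_range_succ]
        linarith [((hG i).2.2.2.2 t n hn).1]
    · suffices ∀ i, ‖starDefect (G i t) (d n).2.1‖
          ≤ ‖starDefect (F t) (d n).2.1‖ + ∑ j ∈ Finset.range i, ε j t from
        (this _).trans (by gcongr; exact he _ _)
      intro i
      induction i with
      | zero => simp [hG0]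
      | succ i ih =>
        rw [Finset.sum_range_succ]
        linarith [((hG i).2.2.2.2 t n hn).2.1]
    · suffices ∀ i, ‖mulDefect (G i t) (d n).2.1 (d n).2.2‖
          ≤ C + ∑ j ∈ Finset.range i, ε j t from
        (this _).trans (by gcongr; exact he _ _)
      intro i
      induction i with
      | zero => simpa [hG0] using h0
      | succ i ih =>
        rw [Finset.sum_range_succ]
        have h1 := ((hG i).2.2.2.2 t n hn).2.2
        have h2 : 0 ≤ ∑ j ∈ Finset.range i, ε j t :=
          Finset.sum_nonneg fun j _ => (hε0 j t).le
        have h3 := max_le ih ((hC i).trans (le_add_of_nonneg_right h2))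
        linarith

end Iteration

section AsymptoticHom

variable {A A' B T : Type*} [NonUnitalCStarAlgebra A] [NonUnitalCStarAlgebra A']
  [NonUnitalCStarAlgebra B]

/-- The maps `F t` are asymptotically linear, multiplicative and star-preserving along `l`. -/
structure IsAsymptoticHomAlong (l : Filter T) (F : T → B → A) : Prop where
  tendsto_mul : ∀ a b, Tendsto (fun t => ‖mulDefect (F t) a b‖) l (𝓝 0)
  tendsto_lin : ∀ μ ν a b, Tendsto (fun t => ‖linDefect (F t) μ ν a b‖) l (𝓝 0)
  tendsto_star : ∀ a, Tendsto (fun t => ‖starDefect (F t) a‖) l (𝓝 0)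

lemma linDefect_comp (j : A →⋆ₙₐ[ℂ] A') (G : B → A) (μ ν : ℂ) (a b : B) :
    linDefect (fun b => j (G b)) μ ν a b = j (linDefect G μ ν a b) := by
  simp [linDefect]

lemma mulDefect_comp (j : A →⋆ₙₐ[ℂ] A') (G : B → A) (a b : B) :
    mulDefect (fun b => j (G b)) a b = j (mulDefect G a b) := by
  simp [mulDefect]

lemma starDefect_comp (j : A →⋆ₙₐ[ℂ] A') (G : B → A) (a : B) :
    starDefect (fun b => j (G b)) a = j (starDefect G a) := by
  simp [starDefect, map_star]

namespace IsAsymptoticHomAlong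

variable {l : Filter T} {F : T → B → A}

lemma comp (hF : IsAsymptoticHomAlong l F) (j : A →⋆ₙₐ[ℂ] A') :
    IsAsymptoticHomAlong l fun t b => j (F t b) where
  tendsto_mul a b := by
    simp only [mulDefect_comp]
    exact squeeze_zero (fun _ => norm_nonneg _)
      (fun _ => NonUnitalStarAlgHom.norm_apply_le j _) (hF.tendsto_mul a b)
  tendsto_lin μ ν a b := by
    simp only [linDefect_comp]
    exact squeeze_zero (fun _ => norm_nonneg _)
      (fun _ => NonUnitalStarAlgHom.norm_apply_le j _) (hF.tendsto_lin μ ν a b)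
  tendsto_star a := by
    simp only [starDefect_comp]
    exact squeeze_zero (fun _ => norm_nonneg _)
      (fun _ => NonUnitalStarAlgHom.norm_apply_le j _) (hF.tendsto_star a)

lemma of_comp {j : A →⋆ₙₐ[ℂ] A'} (hj : Function.Injective j)
    (hF : IsAsymptoticHomAlong l fun t b => j (F t b)) : IsAsymptoticHomAlong l F where
  tendsto_mul a b := by
    simpa only [mulDefect_comp, NonUnitalStarAlgHom.norm_map j hj] using hF.tendsto_mul a b
  tendsto_lin μ ν a b := by
    simpa only [linDefect_comp, NonUnitalStarAlgHom.norm_map j hj] using hF.tendsto_lin μ ν a b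
  tendsto_star a := by
    simpa only [starDefect_comp, NonUnitalStarAlgHom.norm_map j hj] using hF.tendsto_star a

end IsAsymptoticHomAlong

end AsymptoticHom

section Asymptotic

variable {A B T : Type*} [CStarAlgebra A] [NonUnitalCStarAlgebra B]

lemma sq_norm_le_of_approx {a p : A} {δ κ : ℝ} (hδ : ‖star a * a - (p + p - p * p)‖ ≤ δ)
    (hκ : ‖star p - p‖ ≤ κ) : ‖a‖ ^ 2 ≤ 1 + δ + κ ^ 2 / 2 := by
  let _ := CStarAlgebra.spectralOrder A
  let _ := CStarAlgebra.spectralOrderedRing A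
  set E := star a * a - (p + p - p * p) with hE
  set k := star p - p with hk
  set u := 1 - p with hu
  have hδ0 : 0 ≤ δ := (norm_nonneg _).trans hδ
  have hsum : star a * a + star a * a
      = 1 + 1 + k * star k + (E + star E) - star u * u - u * star u := by
    simp only [hE, hk, hu, star_sub, star_add, star_mul, star_star, star_one]
    noncomm_ring
  have h1 : k * star k ≤ algebraMap ℝ A (κ ^ 2) := by
    have h := (IsSelfAdjoint.mul_star_self k).le_algebraMap_norm_self
    rw [CStarRing.norm_self_mul_star, ← sq] at h
    exact h.trans (algebraMap_mono A (by gcongr))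
  have h2 : E + star E ≤ algebraMap ℝ A (2 * δ) := by
    have h := (IsSelfAdjoint.add_star_self E).le_algebraMap_norm_self
    refine h.trans (algebraMap_mono A ((norm_add_le _ _).trans ?_))
    rw [norm_star]; linarith
  have hle : star a * a + star a * a ≤ algebraMap ℝ A (2 + 2 * δ + κ ^ 2) := by
    rw [hsum]
    calc _ ≤ 1 + 1 + k * star k + (E + star E) - star u * u :=
          sub_le_self _ (mul_star_self_nonneg u)
      _ ≤ 1 + 1 + k * star k + (E + star E) := sub_le_self _ (star_mul_self_nonneg u)
      _ ≤ 1 + 1 + algebraMap ℝ A (κ ^ 2) + algebraMap ℝ A (2 * δ) := by gcongr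
      _ = algebraMap ℝ A (2 + 2 * δ + κ ^ 2) := by
        rw [map_add, map_add, map_ofNat, one_add_one_eq_two]; abel
  have hn := (CStarAlgebra.norm_le_iff_le_algebraMap _ (by positivity)
    (add_nonneg (star_mul_self_nonneg a) (star_mul_self_nonneg a))).2 hle
  rw [← two_smul ℝ, norm_smul, CStarRing.norm_star_mul_self, Real.norm_ofNat] at hn
  nlinarith

lemma exists_add_self_sub_mul_self_eq {c : B} (hc : ‖c‖ ≤ 1) :
    ∃ y : B, IsSelfAdjoint y ∧ y + y - y * y = star c * c := by
  let _ := CStarAlgebra.spectralOrder B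
  let _ := CStarAlgebra.spectralOrderedRing B
  have hsa : IsSelfAdjoint (star c * c) := IsSelfAdjoint.star_mul_self c
  have hspec : ∀ x ∈ quasispectrum ℝ (star c * c), x ≤ 1 := by
    intro x hx
    have h1 : ‖star c * c‖ ≤ 1 := by
      rw [CStarRing.norm_star_mul_self]
      nlinarith [norm_nonneg c]
    have := NonUnitalIsometricContinuousFunctionalCalculus.norm_quasispectrum_le (𝕜 := ℝ)
      (star c * c) hx hsa
    exact (le_abs_self x).trans (this.trans h1)
  set g : ℝ → ℝ := fun x => 1 - √(1 - x) with hg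
  have hgc : Continuous g := by fun_prop
  have hg0 : g 0 = 0 := by simp [hg]
  refine ⟨cfcₙ g (star c * c), cfcₙ_predicate g _, ?_⟩
  rw [← cfcₙ_mul (fun x => g x) (fun x => g x) _ hgc.continuousOn hg0 hgc.continuousOn hg0,
    ← cfcₙ_add (fun x => g x) (fun x => g x) _ hgc.continuousOn hg0 hgc.continuousOn hg0,
    ← cfcₙ_sub _ _ _ (by fun_prop) (by simp [hg0]) (by fun_prop) (by simp [hg0])]
  conv_rhs => rw [← cfcₙ_id' ℝ (star c * c)]
  refine cfcₙ_congr fun x hx => ?_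
  have := Real.mul_self_sqrt (sub_nonneg.2 (hspec x hx))
  simp only [hg]
  linear_combination -this

namespace IsAsymptoticHomAlong

variable {l : Filter T} {F : T → B → A}

lemma eventually_norm_le_two (hF : IsAsymptoticHomAlong l F) {c : B} (hc : ‖c‖ ≤ 1) :
    ∀ᶠ t in l, ‖F t c‖ ≤ 2 := by
  obtain ⟨y, hsy, hy⟩ := exists_add_self_sub_mul_self_eq hc
  have hev : ∀ {f : T → ℝ}, Tendsto f l (𝓝 0) → ∀ᶠ t in l, f t ≤ 1 / 4 := fun h =>
    h.eventually_le_const (by norm_num)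
  filter_upwards [hev (hF.tendsto_star c), hev (hF.tendsto_star y), hev (hF.tendsto_mul (star c) c), hev (hF.tendsto_mul y y),
    hev (hF.tendsto_lin 2 (-1) y (y * y))] with t h1 h2 h3 h4 h5
  rw [mulDefect] at h3 h4
  rw [starDefect] at h1 h2
  rw [linDefect, two_smul, neg_one_smul, two_smul, neg_one_smul, ← sub_eq_add_neg,
    ← sub_eq_add_neg, hy] at h5
  rw [hsy.star_eq] at h2
  have hE : star (F t c) * F t c - (F t y + F t y - F t y * F t y)
      = (F t (star c * c) - (F t y + F t y - F t (y * y)))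
        - (F t (star c) - star (F t c)) * F t c - (F t (star c * c) - F t (star c) * F t c)
        - (F t (y * y) - F t y * F t y) := by noncomm_ring
  have hle := norm_sub_le_of_le (norm_sub_le_of_le (norm_sub_le_of_le h5
    (norm_mul_le_of_le h1 (le_refl ‖F t c‖))) h3) h4
  rw [← hE] at hle
  have := sq_norm_le_of_approx hle ((norm_sub_rev _ _).trans_le h2)
  nlinarith [norm_nonneg (F t c)]

lemma eventually_norm_le (hF : IsAsymptoticHomAlong l F) {c : B} {η : ℝ} (hη : 0 < η)
    (hc : ‖c‖ ≤ η) : ∀ᶠ t in l, ‖F t c‖ ≤ 3 * η := by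
  have hη' : (η : ℂ) ≠ 0 := by exact_mod_cast hη.ne'
  have h1 : ‖(η : ℂ)⁻¹ • c‖ ≤ 1 := by
    rw [norm_smul, norm_inv, Complex.norm_of_nonneg hη.le]
    exact (inv_mul_le_one₀ hη).2 hc
  filter_upwards [hF.eventually_norm_le_two h1,
    (hF.tendsto_lin η 0 ((η : ℂ)⁻¹ • c) 0).eventually_le_const hη] with t h2 h3
  rw [linDefect, smul_inv_smul₀ hη', zero_smul, add_zero, zero_smul, add_zero] at h3
  have h4 : ‖(η : ℂ) • F t ((η : ℂ)⁻¹ • c)‖ ≤ η * 2 := by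
    rw [norm_smul, Complex.norm_of_nonneg hη.le]; gcongr
  have := norm_add_le_of_le h3 h4
  rw [sub_add_cancel] at this
  linarith

lemma eventually_norm_sub_le (hF : IsAsymptoticHomAlong l F) {c c' : B} {η : ℝ} (hη : 0 < η)
    (hc : ‖c - c'‖ ≤ η) : ∀ᶠ t in l, ‖F t c - F t c'‖ ≤ 4 * η := by
  filter_upwards [hF.eventually_norm_le hη hc,
    (hF.tendsto_lin 1 (-1) c c').eventually_le_const hη] with t h1 h2
  rw [linDefect, one_smul, one_smul, neg_one_smul, neg_one_smul, ← sub_eq_add_neg,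
    ← sub_eq_add_neg] at h2
  have := norm_sub_le_of_le h1 h2
  rw [sub_sub_cancel] at this
  linarith

end IsAsymptoticHomAlong

/-- Asymptotic continuity at `x` of a family of maps, along the filter `l`. -/
def AsymptoticallyContinuousAt {X : Type*} [TopologicalSpace X] (l : Filter T) (u : T → X → A)
    (x : X) : Prop :=
  ∀ η > 0, ∀ᶠ x' in 𝓝 x, ∀ᶠ t in l, ‖u t x' - u t x‖ ≤ η

namespace AsymptoticallyContinuousAt

variable {X Y : Type*} [TopologicalSpace X] [TopologicalSpace Y] {l : Filter T} {u v : T → X → A}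
  {x : X}

lemma of_continuousAt {f : X → A} (hf : ContinuousAt f x) :
    AsymptoticallyContinuousAt l (fun _ => f) x := fun η hη => by
  filter_upwards [hf.eventually (Metric.closedBall_mem_nhds _ hη)] with x' hx'
  exact Eventually.of_forall fun _ => by simpa [dist_eq_norm] using hx'

lemma comp {f : Y → X} {y : Y} (hu : AsymptoticallyContinuousAt l u (f y))
    (hf : ContinuousAt f y) : AsymptoticallyContinuousAt l (fun t y => u t (f y)) y :=
  fun η hη => hf.eventually (hu η hη)

protected lemma star (hu : AsymptoticallyContinuousAt l u x) :
    AsymptoticallyContinuousAt l (fun t x => star (u t x)) x := fun η hη => by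
  simpa only [← star_sub, norm_star] using hu η hη

lemma add (hu : AsymptoticallyContinuousAt l u x) (hv : AsymptoticallyContinuousAt l v x) :
    AsymptoticallyContinuousAt l (fun t x => u t x + v t x) x := fun η hη => by
  filter_upwards [hu (η / 2) (half_pos hη), hv (η / 2) (half_pos hη)] with x' h1 h2
  filter_upwards [h1, h2] with t h1 h2
  rw [add_sub_add_comm]
  exact (norm_add_le_of_le h1 h2).trans_eq (add_halves η)

lemma sub (hu : AsymptoticallyContinuousAt l u x) (hv : AsymptoticallyContinuousAt l v x) :
    AsymptoticallyContinuousAt l (fun t x => u t x - v t x) x := fun η hη => by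
  filter_upwards [hu (η / 2) (half_pos hη), hv (η / 2) (half_pos hη)] with x' h1 h2
  filter_upwards [h1, h2] with t h1 h2
  rw [sub_sub_sub_comm]
  exact (norm_sub_le_of_le h1 h2).trans_eq (add_halves η)

lemma mul (hu : AsymptoticallyContinuousAt l u x) (hv : AsymptoticallyContinuousAt l v x)
    (hub : ∃ C, ∀ᶠ t in l, ‖u t x‖ ≤ C) (hvb : ∃ C, ∀ᶠ t in l, ‖v t x‖ ≤ C) :
    AsymptoticallyContinuousAt l (fun t x => u t x * v t x) x := fun η hη => by
  obtain ⟨C, hC⟩ := hub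
  obtain ⟨C', hC'⟩ := hvb
  set K := max 0 (max C C') with hK
  have hK0 : 0 ≤ K := le_max_left _ _
  set θ := min 1 (η / (2 * K + 1)) with hθ
  have hK1 : 0 < 2 * K + 1 := by positivity
  have hθ0 : 0 < θ := lt_min one_pos (div_pos hη hK1)
  have hθη : θ * (2 * K + 1) ≤ η := by
    rw [← le_div_iff₀ hK1]; exact min_le_right _ _
  filter_upwards [hu θ hθ0, hv θ hθ0] with x' h1 h2
  filter_upwards [h1, h2, hC, hC'] with t h1 h2 h3 h4
  have e : u t x' * v t x' - u t x * v t x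
      = (u t x' - u t x) * (v t x' - v t x) + (u t x' - u t x) * v t x
        + u t x * (v t x' - v t x) := by noncomm_ring
  rw [e]
  have h5 := norm_add₃_le.trans (add_le_add (add_le_add (norm_mul_le_of_le h1 h2)
    (norm_mul_le_of_le h1 (h4.trans ((le_max_right C C').trans (le_max_right 0 (max C C'))))))
    (norm_mul_le_of_le (h3.trans ((le_max_left C C').trans (le_max_right 0 (max C C')))) h2))
  refine h5.trans (le_trans ?_ hθη)
  have : θ * θ ≤ θ * 1 := by gcongr; exact min_le_left _ _
  linarith

lemma smul {c : X → ℂ} (hc : ContinuousAt c x) (hu : AsymptoticallyContinuousAt l u x)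
    (hub : ∃ C, ∀ᶠ t in l, ‖u t x‖ ≤ C) :
    AsymptoticallyContinuousAt l (fun t x => c x • u t x) x := by
  simp only [Algebra.smul_def]
  exact (of_continuousAt (f := fun x => algebraMap ℂ A (c x))
    ((continuous_algebraMap ℂ A).continuousAt.comp hc)).mul hu
    ⟨_, Eventually.of_forall fun _ => le_rfl⟩ hub

lemma tendsto_norm_zero {d : ℕ → X} (hd : DenseRange d) (hu : AsymptoticallyContinuousAt l u x)
    (h : ∀ n, Tendsto (fun t => ‖u t (d n)‖) l (𝓝 0)) : Tendsto (fun t => ‖u t x‖) l (𝓝 0) := by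
  refine tendsto_order.2 ⟨fun a ha => Eventually.of_forall fun t => ha.trans_le (norm_nonneg _),
    fun η hη => ?_⟩
  obtain ⟨_, ⟨n, rfl⟩, hn⟩ :=
    ((mem_closure_iff_frequently.1 (hd x)).and_eventually (hu (η / 2) (half_pos hη))).exists
  filter_upwards [hn, (h n).eventually_lt_const (half_pos hη)] with t h1 h2
  have := norm_sub_le (u t (d n)) (u t (d n) - u t x)
  rw [sub_sub_cancel] at this
  linarith

end AsymptoticallyContinuousAt

lemma IsAsymptoticHomAlong.of_denseRange {l : Filter T} {H : T → B → A}
    {d : ℕ → (ℂ × ℂ) × B × B} (hd : DenseRange d) (hH : ∀ b, AsymptoticallyContinuousAt l H b)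
    (hbd : ∀ b, ∃ C, ∀ᶠ t in l, ‖H t b‖ ≤ C)
    (hmul : ∀ n, Tendsto (fun t => ‖mulDefect (H t) (d n).2.1 (d n).2.2‖) l (𝓝 0))
    (hlin : ∀ n, Tendsto
      (fun t => ‖linDefect (H t) (d n).1.1 (d n).1.2 (d n).2.1 (d n).2.2‖) l (𝓝 0))
    (hstar : ∀ n, Tendsto (fun t => ‖starDefect (H t) (d n).2.1‖) l (𝓝 0)) :
    IsAsymptoticHomAlong l H where
  tendsto_mul a b := by
    refine AsymptoticallyContinuousAt.tendsto_norm_zero (x := ((0, 0), a, b))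
      (u := fun t (x : (ℂ × ℂ) × B × B) => mulDefect (H t) x.2.1 x.2.2) hd ?_ hmul
    exact ((hH _).comp (f := fun x : (ℂ × ℂ) × B × B => x.2.1 * x.2.2) (by fun_prop)).sub
      (((hH _).comp (f := fun x : (ℂ × ℂ) × B × B => x.2.1) (by fun_prop)).mul
        ((hH _).comp (f := fun x : (ℂ × ℂ) × B × B => x.2.2) (by fun_prop)) (hbd _) (hbd _))
  tendsto_lin μ ν a b := by
    refine AsymptoticallyContinuousAt.tendsto_norm_zero (x := ((μ, ν), a, b))
      (u := fun t (x : (ℂ × ℂ) × B × B) => linDefect (H t) x.1.1 x.1.2 x.2.1 x.2.2) hd ?_ hlin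
    exact ((hH _).comp (f := fun x : (ℂ × ℂ) × B × B => x.1.1 • x.2.1 + x.1.2 • x.2.2)
      (by fun_prop)).sub
      ((((hH _).comp (f := fun x : (ℂ × ℂ) × B × B => x.2.1) (by fun_prop)).smul
        (c := fun x : (ℂ × ℂ) × B × B => x.1.1) (by fun_prop) (hbd _)).add
      (((hH _).comp (f := fun x : (ℂ × ℂ) × B × B => x.2.2) (by fun_prop)).smul
        (c := fun x : (ℂ × ℂ) × B × B => x.1.2) (by fun_prop) (hbd _)))
  tendsto_star a := by
    refine AsymptoticallyContinuousAt.tendsto_norm_zero (x := ((0, 0), a, 0))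
      (u := fun t (x : (ℂ × ℂ) × B × B) => starDefect (H t) x.2.1) hd ?_ hstar
    exact ((hH _).comp (f := fun x : (ℂ × ℂ) × B × B => star x.2.1)
      (by fun_prop)).sub
      ((hH _).comp (f := fun x : (ℂ × ℂ) × B × B => x.2.1) (by fun_prop)).star

end Asymptotic

/-- Evaluation at a point, as a homomorphism on continuous functions. -/
def evalNonUnitalStarAlgHom {X Q : Type*} [TopologicalSpace X] [NonUnitalCStarAlgebra Q] (x : X) :
    C(X, Q) →⋆ₙₐ[ℂ] Q where
  toFun f := f x
  map_smul' _ _ := rfl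
  map_zero' := rfl
  map_add' _ _ := rfl
  map_mul' _ _ := rfl
  map_star' _ := rfl

section EndLift

variable {A Q B T : Type*} [CStarAlgebra A] [CStarAlgebra Q] [NonUnitalCStarAlgebra B]
  [TopologicalSpace T]

/-- A surjective homomorphism of C⋆-algebras has a continuous section preserving zero. -/
lemma exists_continuous_section (π : A →⋆ₐ[ℂ] Q) (hπ : Function.Surjective π) :
    ∃ σ : Q → A, Continuous σ ∧ (∀ x, π (σ x) = x) ∧ σ 0 = 0 :=
  exists_continuous_rightInverse
    ((π.toAlgHom.toLinearMap.restrictScalars ℝ).mkContinuous 1 fun x => by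
      simpa using NonUnitalStarAlgHom.norm_apply_le π x) hπ

/-- Lifting along a homotopy: if the start of a homotopy of homomorphisms into a quotient lifts to
an asymptotic homomorphism, then so does its end. -/
theorem exists_asymptotic_lift_end [NormalSpace T] [ParacompactSpace T]
    [TopologicalSpace.SeparableSpace B] (π : A →⋆ₐ[ℂ] Q) (hπ : Function.Surjective π)
    (Φ : B →⋆ₙₐ[ℂ] C(unitInterval, Q)) {l : Filter T} {ρ : T → ℝ} (hρ : Continuous ρ)
    (hρ0 : ∀ t, 0 ≤ ρ t) (hρl : Tendsto ρ l atTop) {F : T → B → A}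
    (hFc : ∀ b, Continuous fun t => F t b) (hF : IsAsymptoticHomAlong l F)
    (hπF : ∀ t b, π (F t b) = Φ b 0) :
    ∃ H : T → B → A, (∀ b, Continuous fun t => H t b) ∧ IsAsymptoticHomAlong l H ∧
      (∀ t b, π (H t b) = Φ b 1) ∧ ∀ b, ∃ C, ∀ᶠ t in l, ‖H t b‖ ≤ C := by
  obtain ⟨σ, hσ, hπσ, hσ0⟩ := exists_continuous_section π hπ
  obtain ⟨d, hd⟩ := TopologicalSpace.exists_dense_seq ((ℂ × ℂ) × B × B)
  have hΦ : Continuous Φ := AddMonoidHomClass.continuous_of_bound Φ 1 fun x => by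
    simpa using NonUnitalStarAlgHom.norm_apply_le Φ x
  have hρ1 : ∀ t, 0 < 1 + ρ t := fun t => by linarith [hρ0 t]
  have hρc : Continuous fun t => 1 + ρ t := continuous_const.add hρ
  let s : ℕ → T → unitInterval := fun i t => Set.projIcc 0 1 zero_le_one (i / (1 + ρ t))
  have hs : ∀ i, Continuous (s i) := fun i =>
    continuous_projIcc.comp (continuous_const.div hρc fun t => (hρ1 t).ne')
  have hs0 : ∀ t, s 0 t = 0 := fun t => by simp [s]
  have hs1 : ∀ (i : ℕ) t, ρ t + 1 ≤ i → s i t = 1 := fun i t h =>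
    Set.projIcc_of_right_le _ ((one_le_div (hρ1 t)).2 (by linarith))
  have hdist : ∀ i t, dist (s i t) (s (i + 1) t) ≤ 1 / (1 + ρ t) := fun i t => by
    have h := Set.abs_projIcc_sub_projIcc (h := zero_le_one' ℝ) (c := (i : ℝ) / (1 + ρ t))
      (d := ((i + 1 : ℕ) : ℝ) / (1 + ρ t))
    rw [Subtype.dist_eq, Real.dist_eq]
    refine h.trans_eq ?_
    rw [← sub_div, Nat.cast_succ, sub_add_cancel_left, neg_div, abs_neg, abs_of_pos]
    exact one_div_pos.2 (hρ1 t)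
  let ε : ℕ → T → ℝ := fun i t => (1 / 2) ^ i / (1 + ρ t)
  have he : ∀ N t, ∑ i ∈ Finset.range N, ε i t ≤ 2 / (1 + ρ t) := fun N t => by
    rw [← Finset.sum_div]
    gcongr
    · exact (hρ1 t).le
    · exact sum_geometric_two_le N
  let ev : unitInterval → C(unitInterval, Q) →⋆ₙₐ[ℂ] Q := fun x => evalNonUnitalStarAlgHom x
  obtain ⟨H, hHc, hπH, hHsub, hHn, hHd⟩ := exists_iterated_compressed_lift π σ hσ hπσ hρ d
    (ε := ε) (fun i => continuous_const.div hρc fun t => (hρ1 t).ne')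
    (fun i t => div_pos (by positivity) (hρ1 t)) he (fun i t => (ev (s i t)).comp Φ)
    ((ev 1).comp Φ) (fun i t h => by rw [hs1 i t h]) F (fun i t b => σ (Φ b (s i t))) hFc
    (fun i b => hσ.comp ((Φ b).continuous.comp (hs i)))
    (fun t b => by rw [hπF, hs0]; rfl) (fun i t b => hπσ _)
  have hlim : Tendsto (fun t => 1 + ρ t) l atTop := tendsto_atTop_add_const_left _ _ hρl
  have helim : Tendsto (fun t => 2 / (1 + ρ t)) l (𝓝 0) := hlim.const_div_atTop 2
  have hnlim : ∀ n : ℕ, ∀ᶠ t in l, (n : ℝ) ≤ ρ t := fun n => hρl.eventually_ge_atTop _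
  have hbd : ∀ b, ∃ C, ∀ᶠ t in l, ‖H t b‖ ≤ C := fun b => by
    let Lb : C(unitInterval, A) := (⟨σ, hσ⟩ : C(Q, A)).comp (Φ b)
    refine ⟨max (3 * (‖b‖ + 1)) ‖Lb‖, ?_⟩
    filter_upwards [hF.eventually_norm_le (η := ‖b‖ + 1) (by positivity) (by linarith)] with t ht
    exact hHn t b _ (ht.trans (le_max_left _ _))
      fun i => (Lb.norm_coe_le_norm _).trans (le_max_right _ _)
  refine ⟨H, hHc, .of_denseRange hd (fun b η hη => ?_) hbd (fun n => ?_) (fun n => ?_)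
    (fun n => ?_), hπH, hbd⟩
  · let L : B → C(unitInterval, A) := fun b => (⟨σ, hσ⟩ : C(Q, A)).comp (Φ b)
    have hL : Continuous L := (ContinuousMap.continuous_postcomp _).comp hΦ
    filter_upwards [hL.continuousAt.eventually (Metric.closedBall_mem_nhds _ hη),
      Metric.closedBall_mem_nhds b (show 0 < η / 4 by linarith)] with b' h1 h2
    rw [dist_eq_norm] at h1
    rw [mem_closedBall_iff_norm] at h2
    filter_upwards [hF.eventually_norm_sub_le (show 0 < η / 4 by linarith) h2] with t ht
    exact hHsub t b' b η (ht.trans_eq (by ring))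
      fun i => ((L b' - L b).norm_coe_le_norm (s i t)).trans h1
  · set a := (d n).2.1
    set b := (d n).2.2
    refine tendsto_order.2 ⟨fun c hc => Eventually.of_forall fun t => hc.trans_le (norm_nonneg _),
      fun η hη => ?_⟩
    let Ψ : unitInterval × unitInterval → A := fun x =>
      σ ((Φ a x.1 - Φ a x.2) * (Φ b x.1 - Φ b x.2))
    have hΨ : Continuous Ψ := by
      have ha := (Φ a).continuous
      have hb := (Φ b).continuous
      fun_prop
    obtain ⟨r, hr, hrΨ⟩ := Metric.uniformContinuous_iff.1
      (CompactSpace.uniformContinuous_of_continuous hΨ) (η / 2) (half_pos hη)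
    filter_upwards [hnlim n, helim.eventually_lt_const (half_pos hη),
      (hlim.const_div_atTop 1).eventually_lt_const hr,
      (hF.tendsto_mul a b).eventually_le_const (half_pos hη)] with t h1 h2 h3 h4
    refine ((hHd t n h1).2.2 (η / 2) h4 fun i => ?_).trans_lt (by linarith)
    have h5 : dist (s i t, s (i + 1) t) (s i t, s i t) < r := by
      rw [Prod.dist_eq, dist_self, max_eq_right dist_nonneg, dist_comm]
      exact (hdist i t).trans_lt h3
    have h6 := hrΨ h5
    have h7 : Ψ (s i t, s i t) = 0 := by simp [Ψ, hσ0]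
    rw [h7, dist_zero_right] at h6
    exact h6.le
  · refine squeeze_zero' (Eventually.of_forall fun t => norm_nonneg _) ?_
      (by simpa using (hF.tendsto_lin (d n).1.1 (d n).1.2 (d n).2.1 (d n).2.2).add helim)
    filter_upwards [hnlim n] with t ht using (hHd t n ht).1
  · refine squeeze_zero' (Eventually.of_forall fun t => norm_nonneg _) ?_
      (by simpa using (hF.tendsto_star (d n).2.1).add helim)
    filter_upwards [hnlim n] with t ht using (hHd t n ht).2.1

end EndLift

section Reduction

variable {B D Q T X : Type*} [NonUnitalCStarAlgebra B] [NonUnitalCStarAlgebra D]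
  [NonUnitalCStarAlgebra Q]

/-- The inclusion of an algebra into the continuous functions, as the constants. -/
def constNonUnitalStarAlgHom (X D : Type*) [TopologicalSpace X]
    [NonUnitalCStarAlgebra D] : D →⋆ₙₐ[ℂ] C(X, D) where
  toFun := ContinuousMap.const X
  map_smul' _ _ := rfl
  map_zero' := rfl
  map_add' _ _ := rfl
  map_mul' _ _ := rfl
  map_star' _ := rfl

lemma continuous_inr_unitization : Continuous ((↑) : D → Unitization ℂ D) :=
  Unitization.isometry_inr.continuous

/-- Composition with the inclusion of an algebra into its unitization. -/
def compInrNonUnitalStarAlgHom (X D : Type*) [TopologicalSpace X]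
    [NonUnitalCStarAlgebra D] : C(X, D) →⋆ₙₐ[ℂ] C(X, Unitization ℂ D) where
  toFun f := ⟨fun x => (f x : Unitization ℂ D), continuous_inr_unitization.comp f.continuous⟩
  map_smul' _ _ := ContinuousMap.ext fun _ => Unitization.inr_smul _ _ _
  map_zero' := ContinuousMap.ext fun _ => Unitization.inr_zero _
  map_add' _ _ := ContinuousMap.ext fun _ => Unitization.inr_add _ _ _
  map_mul' _ _ := ContinuousMap.ext fun _ => Unitization.inr_mul _ _ _
  map_star' _ := ContinuousMap.ext fun _ => Unitization.inr_star _

lemma compInrNonUnitalStarAlgHom_apply [TopologicalSpace X] (f : C(X, D)) (x : X) :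
    compInrNonUnitalStarAlgHom X D f x = (f x : Unitization ℂ D) := rfl

lemma compInrNonUnitalStarAlgHom_injective [TopologicalSpace X] :
    Function.Injective (compInrNonUnitalStarAlgHom X D) := fun _ _ h =>
  ContinuousMap.ext fun x => Unitization.inr_injective (DFunLike.congr_fun h x)

/-- A path of functions on the unit interval, contracting `f` to its value at `0`. -/
def contraction (D : Type*) [NonUnitalCStarAlgebra D] :
    C(unitInterval, D) →⋆ₙₐ[ℂ] C(unitInterval, C(unitInterval, D)) where
  toFun f := ContinuousMap.curry ⟨fun p : unitInterval × unitInterval => f (p.1 * p.2), by fun_prop⟩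
  map_smul' _ _ := rfl
  map_zero' := rfl
  map_add' _ _ := rfl
  map_mul' _ _ := rfl
  map_star' _ := rfl

/-- A homotopy of homomorphisms into a quotient lifts to an asymptotic homomorphism if its start
does. -/
theorem exists_asymptotic_lift_homotopy [TopologicalSpace T] [NormalSpace T] [ParacompactSpace T]
    [TopologicalSpace.SeparableSpace B] (q : D →⋆ₙₐ[ℂ] Q) (hq : Function.Surjective q)
    (Φ : B →⋆ₙₐ[ℂ] C(unitInterval, Q)) {l : Filter T} {ρ : T → ℝ} (hρ : Continuous ρ)
    (hρ0 : ∀ t, 0 ≤ ρ t) (hρl : Tendsto ρ l atTop) {F : T → B → D}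
    (hFc : ∀ b, Continuous fun t => F t b) (hF : IsAsymptoticHomAlong l F)
    (hqF : ∀ t b, q (F t b) = Φ b 0) :
    ∃ Γ : T → B → C(unitInterval, D), (∀ b, Continuous fun t => Γ t b) ∧
      IsAsymptoticHomAlong l Γ ∧ (∀ t b s, q (Γ t b s) = Φ b s) ∧
      ∀ b, ∃ C, ∀ᶠ t in l, ‖Γ t b‖ ≤ C := by
  have hq' := Unitization.starMap_surjective (R := ℂ) hq
  have hqc : Continuous (Unitization.starMap (R := ℂ) q) :=
    AddMonoidHomClass.continuous_of_bound (Unitization.starMap (R := ℂ) q) 1 fun x => by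
      simpa using NonUnitalStarAlgHom.norm_apply_le (Unitization.starMap (R := ℂ) q) x
  let π := ContinuousMap.compStarAlgHom unitInterval (Unitization.starMap (R := ℂ) q) hqc
  have hπ : Function.Surjective π := fun f => by
    obtain ⟨σ, hσ, hqσ, -⟩ := exists_continuous_section _ hq'
    exact ⟨(⟨σ, hσ⟩ : C(_, _)).comp f, ContinuousMap.ext fun s => hqσ _⟩
  let j := (compInrNonUnitalStarAlgHom unitInterval D).comp
    (constNonUnitalStarAlgHom unitInterval D)
  have hj : Continuous j := AddMonoidHomClass.continuous_of_bound j 1 fun x => by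
    simpa using NonUnitalStarAlgHom.norm_apply_le j x
  obtain ⟨H, hHc, hH, hπH, hHb⟩ := exists_asymptotic_lift_end π hπ
    ((contraction _).comp ((compInrNonUnitalStarAlgHom unitInterval Q).comp Φ)) hρ hρ0 hρl
    (fun b => hj.comp (hFc b)) (hF.comp j) fun t b => ContinuousMap.ext fun s => by
      change Unitization.starMap q (F t b : Unitization ℂ D) = (Φ b (0 * s) : Unitization ℂ Q)
      rw [Unitization.starMap_inr, hqF, zero_mul]
  have hπH' : ∀ t b s, Unitization.starMap q (H t b s) = (Φ b s : Unitization ℂ Q) :=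
    fun t b s => by
      refine (DFunLike.congr_fun (hπH t b) s).trans ?_
      change (Φ b (1 * s) : Unitization ℂ Q) = _
      rw [one_mul]
  let S : C(Unitization ℂ D, D) := ⟨fun x => x.snd, Unitization.continuous_snd⟩
  have hS : ∀ t b, compInrNonUnitalStarAlgHom unitInterval D (S.comp (H t b)) = H t b :=
    fun t b => ContinuousMap.ext fun s => by
      rw [compInrNonUnitalStarAlgHom_apply]
      refine Unitization.ext ?_ rfl
      simpa using! (congrArg (fun x : Unitization ℂ Q => x.fst) (hπH' t b s)).symm
  have hinj := compInrNonUnitalStarAlgHom_injective (X := unitInterval) (D := D)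
  refine ⟨fun t b => S.comp (H t b), fun b => (ContinuousMap.continuous_postcomp S).comp (hHc b),
    .of_comp hinj (by simpa only [hS] using hH), fun t b s => ?_, fun b => ?_⟩
  · have := hπH' t b s
    rw [← hS, compInrNonUnitalStarAlgHom_apply, Unitization.starMap_inr] at this
    exact Unitization.inr_injective this
  · simpa only [← NonUnitalStarAlgHom.norm_map _ hinj, hS] using hHb b

end Reduction

section Specialization

variable {A A' B : Type*} [NonUnitalCStarAlgebra A] [NonUnitalCStarAlgebra A']
  [NonUnitalCStarAlgebra B]

lemma isAsymptoticHom_iff {f : NNReal → B → A} :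
    IsAsymptoticHom f ↔ (∀ b, Continuous fun t => f t b) ∧ IsAsymptoticHomAlong atTop f :=
  ⟨fun h => ⟨h.1, h.2.1, h.2.2.1, h.2.2.2⟩,
    fun h => ⟨h.1, h.2.tendsto_mul, h.2.tendsto_lin, h.2.tendsto_star⟩⟩

lemma isDiscreteAsymptoticHom_iff {f : ℕ → B → A} :
    IsDiscreteAsymptoticHom f ↔
      IsAsymptoticHomAlong atTop f ∧ ∀ b, ∃ C, ∀ n, ‖f n b‖ ≤ C :=
  ⟨fun h => ⟨⟨h.1, h.2.1, h.2.2.1⟩, h.2.2.2⟩,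
    fun h => ⟨h.1.tendsto_mul, h.1.tendsto_lin, h.1.tendsto_star, h.2⟩⟩

lemma IsAsymptoticHom.comp {f : NNReal → B → A} (hf : IsAsymptoticHom f) (j : A →⋆ₙₐ[ℂ] A') :
    IsAsymptoticHom fun t b => j (f t b) := by
  have hj : Continuous j := AddMonoidHomClass.continuous_of_bound j 1 fun x => by
    simpa using NonUnitalStarAlgHom.norm_apply_le j x
  rw [isAsymptoticHom_iff] at hf ⊢
  exact ⟨fun b => hj.comp (hf.1 b), hf.2.comp j⟩

lemma IsDiscreteAsymptoticHom.comp {f : ℕ → B → A} (hf : IsDiscreteAsymptoticHom f)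
    (j : A →⋆ₙₐ[ℂ] A') : IsDiscreteAsymptoticHom fun t b => j (f t b) := by
  rw [isDiscreteAsymptoticHom_iff] at hf ⊢
  exact ⟨hf.1.comp j, fun b => (hf.2 b).imp fun C hC n =>
    (NonUnitalStarAlgHom.norm_apply_le j _).trans (hC n)⟩

lemma exists_forall_le_of_eventually {u : ℕ → ℝ} (h : ∃ C, ∀ᶠ n in atTop, u n ≤ C) :
    ∃ C, ∀ n, u n ≤ C := by
  have : BddAbove (Set.range u) := by
    simpa [IsBoundedUnder, IsBounded] using IsBoundedUnder.bddAbove_range h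
  exact this.imp fun C hC n => hC ⟨n, rfl⟩

end Specialization

/-- **Homotopy lifting theorem.**  Let `q : D → D/I` be the quotient map (modelled as a
surjective ∗-homomorphism onto `Q`), and let `φ, ψ : B → D/I` be homotopic ∗-homomorphisms,
with homotopy `Φ : B → C([0,1], D/I)`, `ev₀∘Φ = ψ`, `ev₁∘Φ = φ`.  If `ψ` lifts to a
(discrete) asymptotic homomorphism `B → D`, then so does `φ`, and moreover the whole
homotopy lifts. -/
theorem homotopy_lifting
    {B D Q : Type*} [NonUnitalCStarAlgebra B] [NonUnitalCStarAlgebra D] [NonUnitalCStarAlgebra Q]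
    [TopologicalSpace.SeparableSpace B]
    (q : D →⋆ₙₐ[ℂ] Q) (hq : Function.Surjective q)
    (φ ψ : B →⋆ₙₐ[ℂ] Q)
    (Φ : B →⋆ₙₐ[ℂ] C(unitInterval, Q))
    (hΦ0 : ∀ b, Φ b 0 = ψ b) (hΦ1 : ∀ b, Φ b 1 = φ b) :
    -- continuous version
    ((∃ F : NNReal → B → D, IsAsymptoticHom F ∧ ∀ t b, q (F t b) = ψ b) →
      (∃ F : NNReal → B → D, IsAsymptoticHom F ∧ ∀ t b, q (F t b) = φ b) ∧
      (∃ Γ : NNReal → B → C(unitInterval, D), IsAsymptoticHom Γ ∧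
        ∀ t b s, q (Γ t b s) = Φ b s)) ∧
    -- discrete version
    ((∃ F : ℕ → B → D, IsDiscreteAsymptoticHom F ∧ ∀ n b, q (F n b) = ψ b) →
      (∃ F : ℕ → B → D, IsDiscreteAsymptoticHom F ∧ ∀ n b, q (F n b) = φ b) ∧
      (∃ Γ : ℕ → B → C(unitInterval, D), IsDiscreteAsymptoticHom Γ ∧
        ∀ n b s, q (Γ n b s) = Φ b s)) := by
  constructor
  · rintro ⟨F, hF, hqF⟩
    rw [isAsymptoticHom_iff] at hF
    obtain ⟨Γ, hΓc, hΓ, hqΓ, -⟩ := exists_asymptotic_lift_homotopy q hq Φ NNReal.continuous_coe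
      NNReal.coe_nonneg (NNReal.tendsto_coe_atTop.2 tendsto_id) hF.1 hF.2
      fun t b => (hqF t b).trans (hΦ0 b).symm
    have hΓ' := isAsymptoticHom_iff.2 ⟨hΓc, hΓ⟩
    exact ⟨⟨_, hΓ'.comp (evalNonUnitalStarAlgHom 1), fun t b => (hqΓ t b 1).trans (hΦ1 b)⟩,
      Γ, hΓ', hqΓ⟩
  · rintro ⟨F, hF, hqF⟩
    rw [isDiscreteAsymptoticHom_iff] at hF
    obtain ⟨Γ, -, hΓ, hqΓ, hΓb⟩ := exists_asymptotic_lift_homotopy q hq Φ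
      (continuous_of_discreteTopology (f := ((↑) : ℕ → ℝ))) Nat.cast_nonneg
      tendsto_natCast_atTop_atTop (fun _ => continuous_of_discreteTopology) hF.1
      fun t b => (hqF t b).trans (hΦ0 b).symm
    have hΓ' := isDiscreteAsymptoticHom_iff.2
      ⟨hΓ, fun b => exists_forall_le_of_eventually (hΓb b)⟩
    exact ⟨⟨_, hΓ'.comp (evalNonUnitalStarAlgHom 1), fun t b => (hqΓ t b 1).trans (hΦ1 b)⟩,
      Γ, hΓ', hqΓ⟩

end
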